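/- Let d, m ≥ 1, r⃗ ∈ (0,∞)^m, q ∈ (0,∞), s ∈ (q,∞], and set ρ := (1/q − 1/s)^{-1}. Let (Ω,μ) be a σ-finite measure space and let t⃗ ∈ (0,∞]^m with t_j > r_j for all j and q ≤ t < s, t < ∞, where 1/t := ∑_{j=1}^m 1/t_j. Let T be a map assigning to each m-tuple of functions in L^∞_c(ℝ^d) a measurable function on ℝ^d, and suppose there is C_T ≥ 0 such that ‖T(f⃗)·g‖_{L^q(ℝ^d)} ≤ C_T ‖M_{(r_1,…,r_m,ρ)}(f_1,…,f_m,g)‖_{L^q(ℝ^d)} for all f_j, g ∈ L^∞_c(ℝ^d). Suppose further that for all simple, boundedly supported f_j : ℝ^d × Ω → ℂ (finitely many values in each variable pair, bounded, supported in a bounded x-set) the function T̃(f⃗)(x,ω) := T(f_1(·,ω),…,f_m(·,ω))(x) is jointly measurable. Then there is a constant C depending only on d, m, q, r⃗, s, t⃗ such that for all such simple f⃗ and all g ∈ L^∞_c(ℝ^d): ‖ ‖T̃(f⃗)(x,·)‖_{L^t(Ω)} · g(x) ‖_{L^q(ℝ^d,dx)} ≤ C · C_T · ‖M_{(r_1,…,r_m,ρ)}(‖f_1(·,·)‖_{L^{t_1}(Ω)},…,‖f_m(·,·)‖_{L^{t_m}(Ω)},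 g)‖_{L^q(ℝ^d)}. -/

import Mathlib

open MeasureTheory ENNReal

noncomputable section

structure Cube (d : ℕ) where
  corner : Fin d → ℝ
  side : ℝ
  side_pos : 0 < side

namespace Cube
def set {d : ℕ} (Q : Cube d) : Set (Fin d → ℝ) :=
  {x | ∀ i, Q.corner i ≤ x i ∧ x i < Q.corner i + Q.side}
def vol {d : ℕ} (Q : Cube d) : ℝ≥0∞ := volume Q.set
def IsDyadic {d : ℕ} (Q : Cube d) : Prop :=
  ∃ (k : ℤ) (n : Fin d → ℤ), Q.side = (2:ℝ) ^ (-k) ∧ ∀ i, Q.corner i = (2:ℝ) ^ (-k) * (n i : ℝ)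
end Cube

def IsSparse {d : ℕ} (S : Set (Cube d)) : Prop :=
  ∃ E : Cube d → Set (Fin d → ℝ),
    (∀ Q ∈ S, MeasurableSet (E Q) ∧ E Q ⊆ Q.set ∧ Q.vol ≤ 2 * volume (E Q)) ∧
    S.PairwiseDisjoint E

def eNorm {α : Type*} [MeasurableSpace α] (p : ℝ≥0∞) (μ : Measure α) (F : α → ℝ≥0∞) : ℝ≥0∞ :=
  if p = ∞ then essSup F μ else (∫⁻ x, F x ^ p.toReal ∂μ) ^ (1 / p.toReal)

def nn {α : Type*} (f : α → ℂ) : α → ℝ≥0∞ := fun x => (‖f x‖₊ : ℝ≥0∞)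

def avg {d : ℕ} (r : ℝ≥0∞) (F : (Fin d → ℝ) → ℝ≥0∞) (Q : Cube d) : ℝ≥0∞ :=
  if r = ∞ then essSup F (volume.restrict Q.set)
  else ((∫⁻ x in Q.set, F x ^ r.toReal) / Q.vol) ^ (1 / r.toReal)

def maximal {d k : ℕ} (r : Fin k → ℝ≥0∞) (F : Fin k → (Fin d → ℝ) → ℝ≥0∞)
    (x : Fin d → ℝ) : ℝ≥0∞ :=
  ⨆ (Q : Cube d) (_ : x ∈ Q.set), ∏ j, avg (r j) (F j) Q

def maximalX {d k : ℕ} (r : Fin k → ℝ≥0∞) (ρ : ℝ≥0∞) (F : Fin k → (Fin d → ℝ) → ℝ≥0∞)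
    (G : (Fin d → ℝ) → ℝ≥0∞) (x : Fin d → ℝ) : ℝ≥0∞ :=
  ⨆ (Q : Cube d) (_ : x ∈ Q.set), (∏ j, avg (r j) (F j) Q) * avg ρ G Q

def wNorm {d : ℕ} (p : ℝ≥0∞) (w : (Fin d → ℝ) → ℝ) (F : (Fin d → ℝ) → ℝ≥0∞) : ℝ≥0∞ :=
  eNorm p volume (fun x => F x * ENNReal.ofReal (w x))

def aConst {d m : ℕ} (p r : Fin m → ℝ≥0∞) (s : ℝ≥0∞)
    (w : Fin m → (Fin d → ℝ) → ℝ) : ℝ≥0∞ :=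
  ⨆ Q : Cube d,
    (∏ j, avg ((r j)⁻¹ - (p j)⁻¹)⁻¹ (fun x => ENNReal.ofReal (w j x)⁻¹) Q) *
      avg ((∑ j, (p j)⁻¹) - s⁻¹)⁻¹ (fun x => ENNReal.ofReal (∏ j, w j x)) Q

def latAvg {d : ℕ} {Ω : Type*} (r : ℝ≥0∞) (f : (Fin d → ℝ) → Ω → ℂ) (Q : Cube d) (ω : Ω) : ℝ≥0∞ :=
  ((∫⁻ y in Q.set, (‖f y ω‖₊ : ℝ≥0∞) ^ r.toReal) / Q.vol) ^ (1 / r.toReal)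

def latMax {d m : ℕ} {Ω : Type*} (r : Fin m → ℝ≥0∞) (D : Finset (Cube d))
    (f : Fin m → (Fin d → ℝ) → Ω → ℂ) (x : Fin d → ℝ) (ω : Ω) : ℝ≥0∞ :=
  ⨆ Q ∈ D, ⨆ (_ : x ∈ Cube.set Q), ∏ j, latAvg (r j) (f j) Q ω

def latMaxX {d m : ℕ} {Ω : Type*} (r : Fin m → ℝ≥0∞) (ρ : ℝ≥0∞) (D : Finset (Cube d))
    (f : Fin m → (Fin d → ℝ) → Ω → ℂ) (g : (Fin d → ℝ) → Ω → ℂ)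
    (x : Fin d → ℝ) (ω : Ω) : ℝ≥0∞ :=
  ⨆ Q ∈ D, ⨆ (_ : x ∈ Cube.set Q), (∏ j, latAvg (r j) (f j) Q ω) * latAvg ρ g Q ω

def MemLinftyC {d : ℕ} (f : (Fin d → ℝ) → ℂ) : Prop :=
  Measurable f ∧ (∃ M : ℝ, ∀ x, ‖f x‖ ≤ M) ∧ Bornology.IsBounded (Function.support f)

def SimpleLinftyC {d : ℕ} (f : (Fin d → ℝ) → ℂ) : Prop :=
  Measurable f ∧ (Set.range f).Finite ∧ Bornology.IsBounded (Function.support f)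

def PairSimple {d : ℕ} {Ω : Type*} [MeasurableSpace Ω] (f : (Fin d → ℝ) → Ω → ℂ) : Prop :=
  Measurable (Function.uncurry f) ∧ (Set.range (Function.uncurry f)).Finite ∧
    ∃ B : Set (Fin d → ℝ), Bornology.IsBounded B ∧ ∀ x ∉ B, ∀ ω, f x ω = 0

def VecSimple {d : ℕ} {Ω : Type*} [MeasurableSpace Ω] (f : (Fin d → ℝ) → Ω → ℂ) : Prop :=
  ∃ (N : ℕ) (A : Fin N → Set (Fin d → ℝ)) (ξ : Fin N → Ω → ℂ),
    (∀ i, MeasurableSet (A i)) ∧ (∀ i, Bornology.IsBounded (A i)) ∧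
    (∀ i, Measurable (ξ i)) ∧ (∃ M : ℝ, ∀ i ω, ‖ξ i ω‖ ≤ M) ∧
    ∀ x ω, f x ω = ∑ i, (A i).indicator (fun _ => ξ i ω) x

lemma laminar_le {X I : Type*} [MeasurableSpace X] (ν₁ ν₂ : Measure X) (S : I → Set X)
    (hS : ∀ a, MeasurableSet (S a)) (𝓕 : Finset I)
    (lam : ∀ a ∈ 𝓕, ∀ b ∈ 𝓕, S a ⊆ S b ∨ S b ⊆ S a ∨ Disjoint (S a) (S b))
    (h : ∀ a ∈ 𝓕, ν₁ (S a) ≤ ν₂ (S a)) :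
    ν₁ (⋃ a ∈ 𝓕, S a) ≤ ν₂ (⋃ a ∈ 𝓕, S a) := by
  classical
  induction 𝓕 using Finset.strongInduction with
  | H 𝓕 ih =>
    by_cases hex : ∃ a ∈ 𝓕, ∃ b ∈ 𝓕, a ≠ b ∧ S a ⊆ S b
    · obtain ⟨a, ha, b, hb, hab, hsub⟩ := hex
      have hU : (⋃ c ∈ 𝓕, S c) = ⋃ c ∈ 𝓕.erase a, S c := by
        apply Set.Subset.antisymm
        · intro x hx
          simp only [Set.mem_iUnion, exists_prop] at hx ⊢
          obtain ⟨c, hc, hxc⟩ := hx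
          by_cases hca : c = a
          · subst hca
            exact ⟨b, Finset.mem_erase.2 ⟨hab.symm, hb⟩, hsub hxc⟩
          · exact ⟨c, Finset.mem_erase.2 ⟨hca, hc⟩, hxc⟩
        · exact Set.biUnion_subset_biUnion_left (fun c hc => Finset.mem_of_mem_erase hc)
      rw [hU]
      refine ih _ (Finset.erase_ssubset ha) ?_ ?_
      · intro c hc e he
        exact lam c (Finset.mem_of_mem_erase hc) e (Finset.mem_of_mem_erase he)
      · intro c hc
        exact h c (Finset.mem_of_mem_erase hc)
    · push Not at hex
      have hd : (𝓕 : Set I).PairwiseDisjoint S := by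
        intro a ha b hb hab
        rcases lam a ha b hb with h1 | h1 | h1
        · exact absurd h1 (hex a ha b hb hab)
        · exact absurd h1 (hex b hb a ha hab.symm)
        · exact h1
      rw [measure_biUnion_finset hd (fun b _ => hS b), measure_biUnion_finset hd (fun b _ => hS b)]
      exact Finset.sum_le_sum h

lemma layer_real {p : ℝ} (hp : 0 < p) (x : ℝ) (hx : 0 ≤ x) :
    ENNReal.ofReal (x ^ p) = ENNReal.ofReal p *
      ∫⁻ τ in Set.Ioi (0:ℝ), (if ENNReal.ofReal τ < ENNReal.ofReal x then
        ENNReal.ofReal (τ ^ (p - 1)) else 0) := by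
  have h := lintegral_rpow_eq_lintegral_meas_lt_mul (Measure.dirac ()) (f := fun _ => x)
    (Filter.Eventually.of_forall fun _ => hx) aemeasurable_const hp
  simp only [lintegral_dirac] at h
  rw [h]
  congr 1
  apply setLIntegral_congr_fun measurableSet_Ioi
  intro τ hτ
  have hτ' : (0:ℝ) < τ := hτ
  have : (ENNReal.ofReal τ < ENNReal.ofReal x) ↔ τ < x := by
    rw [ENNReal.ofReal_lt_ofReal_iff_of_nonneg hτ'.le]
  by_cases hlt : τ < x
  · simp [this, hlt]
  · simp [this, hlt]

lemma layer {p : ℝ} (hp : 0 < p) (X : ℝ≥0∞) :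
    X ^ p = ENNReal.ofReal p *
      ∫⁻ τ in Set.Ioi (0:ℝ), (if ENNReal.ofReal τ < X then
        ENNReal.ofReal (τ ^ (p - 1)) else 0) := by
  by_cases hX : X = ∞
  · subst hX
    rw [ENNReal.top_rpow_of_pos hp]
    symm
    refine ENNReal.eq_top_of_forall_nnreal_le fun y => ?_
    have h1 := layer_real hp ((y:ℝ) ^ (1/p)) (by positivity)
    rw [← Real.rpow_mul y.coe_nonneg, one_div_mul_cancel hp.ne', Real.rpow_one, ENNReal.ofReal_coe_nnreal] at h1
    rw [h1]
    gcongr with τ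
    split_ifs with h2 h3
    · exact le_rfl
    · exact absurd ENNReal.ofReal_lt_top h3
    · exact zero_le
    · exact le_rfl
  · have h1 := layer_real hp X.toReal ENNReal.toReal_nonneg
    rw [ENNReal.ofReal_toReal hX, ← ENNReal.ofReal_rpow_of_nonneg ENNReal.toReal_nonneg hp.le,
      ENNReal.ofReal_toReal hX] at h1
    exact h1

namespace Cube

lemma set_eq {d : ℕ} (Q : Cube d) :
    Q.set = Set.pi Set.univ (fun i => Set.Ico (Q.corner i) (Q.corner i + Q.side)) := by
  ext x; simp [Cube.set]

lemma meas {d : ℕ} (Q : Cube d) : MeasurableSet Q.set := by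
  rw [set_eq]
  exact MeasurableSet.univ_pi (fun i => measurableSet_Ico)

lemma vol_eq {d : ℕ} (Q : Cube d) : volume Q.set = ENNReal.ofReal (Q.side ^ d) := by
  rw [set_eq, Real.volume_pi_Ico]
  simp only [add_sub_cancel_left, Finset.prod_const, Finset.card_univ, Fintype.card_fin]
  rw [ENNReal.ofReal_pow Q.side_pos.le]

lemma vol_ne_zero {d : ℕ} (Q : Cube d) : volume Q.set ≠ 0 := by
  rw [vol_eq]; simpa using pow_pos Q.side_pos d

lemma vol_ne_top {d : ℕ} (Q : Cube d) : volume Q.set ≠ ∞ := by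
  rw [vol_eq]; exact ENNReal.ofReal_ne_top

end Cube

/-- nested or disjoint -/
def Laminar {d : ℕ} (𝓕 : Set (Cube d)) : Prop :=
  ∀ a ∈ 𝓕, ∀ b ∈ 𝓕, a.set ⊆ b.set ∨ b.set ⊆ a.set ∨ Disjoint a.set b.set

lemma laminar_cubes {d : ℕ} (ν₁ ν₂ : Measure (Fin d → ℝ)) (𝓕 : Finset (Cube d))
    (lam : Laminar (𝓕 : Set (Cube d)))
    (h : ∀ a ∈ 𝓕, ν₁ a.set ≤ ν₂ a.set) :
    ν₁ (⋃ a ∈ 𝓕, a.set) ≤ ν₂ (⋃ a ∈ 𝓕, a.set) :=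
  laminar_le ν₁ ν₂ Cube.set Cube.meas 𝓕 lam h

/-- the finite maximal function with general weights -/
def fmax {d : ℕ} (𝓕 : Finset (Cube d)) (c : Cube d → ℝ≥0∞) (x : Fin d → ℝ) : ℝ≥0∞ :=
  ⨆ Q ∈ 𝓕, Q.set.indicator (fun _ => c Q) x

lemma lt_fmax {d : ℕ} (𝓕 : Finset (Cube d)) (c : Cube d → ℝ≥0∞) (x : Fin d → ℝ) (τ : ℝ≥0∞) :
    τ < fmax 𝓕 c x ↔ ∃ Q ∈ 𝓕, x ∈ Q.set ∧ τ < c Q := by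
  unfold fmax
  simp only [lt_iSup_iff, exists_prop]
  constructor
  · rintro ⟨Q, hQ, h⟩
    by_cases hx : x ∈ Q.set
    · rw [Set.indicator_of_mem hx] at h
      exact ⟨Q, hQ, hx, h⟩
    · rw [Set.indicator_of_notMem hx] at h
      exact absurd h ENNReal.not_lt_zero
  · rintro ⟨Q, hQ, hx, h⟩
    exact ⟨Q, hQ, by rwa [Set.indicator_of_mem hx]⟩

lemma measurable_fmax {d : ℕ} (𝓕 : Finset (Cube d)) (c : Cube d → ℝ≥0∞) :
    Measurable (fmax 𝓕 c) := by
  unfold fmax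
  apply Measurable.biSup _ 𝓕.countable_toSet
  intro Q _
  exact measurable_const.indicator Q.meas

lemma weak_type {d : ℕ} (𝓕 : Finset (Cube d)) (lam : Laminar (𝓕 : Set (Cube d)))
    (φ Φ : (Fin d → ℝ) → ℝ≥0∞) (hφ : Measurable φ) (hΦ : Measurable Φ)
    (B : ℝ≥0∞) (hB0 : B ≠ 0) (hB : B ≠ ∞)
    (hΦB : ∀ Q ∈ 𝓕, ∫⁻ x in Q.set, Φ x ≤ B * volume Q.set) (τ : ℝ≥0∞) (hτ : τ ≠ ∞) :
    τ * volume {x | τ < fmax 𝓕 (fun Q => (∫⁻ x in Q.set, φ x) / volume Q.set) x} ≤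
      2 * ∫⁻ x in ⋃ Q ∈ 𝓕, Q.set, (if τ * Φ x < 2 * B * φ x then φ x else 0) := by
  classical
  set c : Cube d → ℝ≥0∞ := fun Q => (∫⁻ x in Q.set, φ x) / volume Q.set with hc
  set ψ : (Fin d → ℝ) → ℝ≥0∞ := fun x => if τ * Φ x < 2 * B * φ x then φ x else 0 with hψ
  have hψm : Measurable ψ :=
    Measurable.ite (measurableSet_lt (hΦ.const_mul _) (hφ.const_mul _)) hφ measurable_const
  set 𝓖 := 𝓕.filter (fun Q => τ < c Q) with h𝓖
  have hset : {x | τ < fmax 𝓕 c x} = ⋃ Q ∈ 𝓖, Q.set := by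
    ext x
    simp only [Set.mem_ofPred_eq, lt_fmax, Set.mem_iUnion, h𝓖, Finset.mem_filter, exists_prop]
    constructor
    · rintro ⟨Q, h1, h2, h3⟩; exact ⟨Q, ⟨h1, h3⟩, h2⟩
    · rintro ⟨Q, ⟨h1, h3⟩, h2⟩; exact ⟨Q, h1, h2, h3⟩
  rw [hset]
  have hpt : ∀ x, φ x ≤ ψ x + τ / (2 * B) * Φ x := by
    intro x
    simp only [hψ]
    split_ifs with h
    · exact le_self_add
    · push Not at h
      rw [zero_add, ← ENNReal.mul_div_right_comm, ENNReal.le_div_iff_mul_le]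
      · rwa [mul_comm]
      · left; simp [hB0]
      · left; exact ENNReal.mul_ne_top (by simp) hB
  have hkey : ∀ Q ∈ 𝓖, (τ • (volume : Measure (Fin d → ℝ))) Q.set ≤
      ((2:ℝ≥0∞) • (volume.withDensity ψ)) Q.set := by
    intro Q hQ
    rw [h𝓖, Finset.mem_filter] at hQ
    obtain ⟨hQ1, hQ2⟩ := hQ
    simp only [Measure.smul_apply, smul_eq_mul]
    rw [withDensity_apply _ Q.meas]
    have h1 : τ * volume Q.set ≤ ∫⁻ x in Q.set, φ x := by
      have := (ENNReal.lt_div_iff_mul_lt (Or.inl Q.vol_ne_zero) (Or.inl Q.vol_ne_top)).1 hQ2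
      exact this.le
    have h2 : ∫⁻ x in Q.set, φ x ≤ (∫⁻ x in Q.set, ψ x) + τ / 2 * volume Q.set := by
      calc ∫⁻ x in Q.set, φ x ≤ ∫⁻ x in Q.set, (ψ x + τ / (2 * B) * Φ x) := lintegral_mono hpt
        _ = (∫⁻ x in Q.set, ψ x) + τ / (2 * B) * ∫⁻ x in Q.set, Φ x := by
            rw [lintegral_add_left hψm, lintegral_const_mul _ hΦ]
        _ ≤ (∫⁻ x in Q.set, ψ x) + τ / (2 * B) * (B * volume Q.set) := by
            gcongr; exact hΦB Q hQ1
        _ = _ := by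
            rw [← mul_assoc]
            congr 2
            rw [div_eq_mul_inv, div_eq_mul_inv, ENNReal.mul_inv (by simp) (by simp), mul_assoc,
              mul_assoc, ENNReal.inv_mul_cancel hB0 hB, mul_one]
    have h3 : τ * volume Q.set = τ / 2 * volume Q.set + τ / 2 * volume Q.set := by
      rw [← add_mul, ENNReal.add_halves]
    have hfin : τ / 2 * volume Q.set ≠ ∞ :=
      ENNReal.mul_ne_top (ENNReal.div_ne_top hτ (by simp)) Q.vol_ne_top
    have h4 : τ / 2 * volume Q.set ≤ ∫⁻ x in Q.set, ψ x := by
      have := h1.trans h2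
      rw [h3] at this
      exact (ENNReal.add_le_add_iff_right hfin).1 this
    rw [h3, two_mul]
    exact add_le_add h4 h4
  have hlamG : Laminar (𝓖 : Set (Cube d)) := fun a ha b hb =>
    lam a (Finset.mem_of_mem_filter a ha) b (Finset.mem_of_mem_filter b hb)
  have := laminar_cubes _ _ 𝓖 hlamG hkey
  simp only [Measure.smul_apply, smul_eq_mul] at this
  refine this.trans ?_
  rw [withDensity_apply _ (Finset.measurableSet_biUnion _ fun Q _ => Q.meas)]
  have hsub : (⋃ Q ∈ 𝓖, Q.set) ⊆ ⋃ Q ∈ 𝓕, Q.set :=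
    Set.biUnion_subset_biUnion_left (fun c hc => Finset.mem_of_mem_filter c hc)
  exact mul_le_mul_right (lintegral_mono_set hsub) _

lemma max_lemma {d : ℕ} (𝓕 : Finset (Cube d)) (lam : Laminar (𝓕 : Set (Cube d)))
    (φ Φ : (Fin d → ℝ) → ℝ≥0∞) (hφ : Measurable φ) (hΦ : Measurable Φ)
    (B : ℝ≥0∞) (hB0 : B ≠ 0) (hB : B ≠ ∞)
    (hΦB : ∀ Q ∈ 𝓕, ∫⁻ x in Q.set, Φ x ≤ B * volume Q.set) (p : ℝ) (hp : 1 < p) :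
    ∫⁻ x, (fmax 𝓕 (fun Q => (∫⁻ x in Q.set, φ x) / volume Q.set) x) ^ p ≤
      ENNReal.ofReal p * 2 * ENNReal.ofReal (p - 1)⁻¹ * (2 * B) ^ (p - 1) *
        ∫⁻ x in ⋃ Q ∈ 𝓕, Q.set, φ x ^ p * (Φ x)⁻¹ ^ (p - 1) := by
  set S := fmax 𝓕 (fun Q => (∫⁻ x in Q.set, φ x) / volume Q.set) with hS
  have hSm : Measurable S := measurable_fmax _ _
  set U := ⋃ Q ∈ 𝓕, Q.set with hU
  have hp0 : 0 < p := by linarith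
  have hp1 : 0 < p - 1 := by linarith
  have hpow : ∀ a : ℝ, Measurable (fun τ : ℝ => ENNReal.ofReal (τ ^ a)) := fun a =>
    (measurable_id.pow_const a).ennreal_ofReal
  calc ∫⁻ x, S x ^ p = ∫⁻ x, ENNReal.ofReal p *
      ∫⁻ τ in Set.Ioi (0:ℝ), (if ENNReal.ofReal τ < S x then
        ENNReal.ofReal (τ ^ (p - 1)) else 0) := by
        apply lintegral_congr; intro x; exact layer hp0 _
    _ = ENNReal.ofReal p * ∫⁻ x, 
      ∫⁻ τ in Set.Ioi (0:ℝ), (if ENNReal.ofReal τ < S x then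
        ENNReal.ofReal (τ ^ (p - 1)) else 0) := by
        rw [lintegral_const_mul' _ _ ENNReal.ofReal_ne_top]
    _ = ENNReal.ofReal p * ∫⁻ τ in Set.Ioi (0:ℝ), ∫⁻ x, (if ENNReal.ofReal τ < S x then
        ENNReal.ofReal (τ ^ (p - 1)) else 0) := by
        congr 1
        apply lintegral_lintegral_swap
        apply Measurable.aemeasurable
        apply Measurable.ite
        · exact measurableSet_lt (measurable_snd.ennreal_ofReal) (hSm.comp measurable_fst)
        · exact (hpow _).comp measurable_snd
        · exact measurable_const
    _ ≤ ENNReal.ofReal p * ∫⁻ τ in Set.Ioi (0:ℝ), 2 * ∫⁻ x in U,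
        (if ENNReal.ofReal τ * Φ x < 2 * B * φ x then
          φ x * ENNReal.ofReal (τ ^ (p - 1 - 1)) else 0) := by
        gcongr ENNReal.ofReal p * ?_
        apply setLIntegral_mono' measurableSet_Ioi
        intro τ hτ
        have hτ' : (0:ℝ) < τ := hτ
        have h1 : ∫⁻ x, (if ENNReal.ofReal τ < S x then
            ENNReal.ofReal (τ ^ (p - 1)) else 0) =
            ENNReal.ofReal (τ ^ (p - 1)) * volume {x | ENNReal.ofReal τ < S x} := by
          rw [← lintegral_indicator_const (measurableSet_lt measurable_const hSm)]
          apply lintegral_congr; intro x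
          simp [Set.indicator_apply]
        have h2 := weak_type 𝓕 lam φ Φ hφ hΦ B hB0 hB hΦB (ENNReal.ofReal τ) ENNReal.ofReal_ne_top
        rw [h1]
        have h3 : ENNReal.ofReal (τ ^ (p - 1)) = ENNReal.ofReal (τ ^ (p - 1 - 1)) * ENNReal.ofReal τ := by
          rw [← ENNReal.ofReal_mul (by positivity)]
          congr 1
          rw [← Real.rpow_add_one hτ'.ne']
          congr 1; ring
        rw [h3, mul_assoc]
        calc _ ≤ ENNReal.ofReal (τ ^ (p - 1 - 1)) * (2 * ∫⁻ x in U,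
            (if ENNReal.ofReal τ * Φ x < 2 * B * φ x then φ x else 0)) := by gcongr
          _ = 2 * (ENNReal.ofReal (τ ^ (p - 1 - 1)) * ∫⁻ x in U,
            (if ENNReal.ofReal τ * Φ x < 2 * B * φ x then φ x else 0)) := by ring
          _ = _ := by
            rw [← lintegral_const_mul' _ _ ENNReal.ofReal_ne_top]
            congr 1
            apply lintegral_congr; intro x
            split_ifs
            · rw [mul_comm]
            · simp
    _ = ENNReal.ofReal p * 2 * ∫⁻ τ in Set.Ioi (0:ℝ), ∫⁻ x in U,
        (if ENNReal.ofReal τ * Φ x < 2 * B * φ x then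
          φ x * ENNReal.ofReal (τ ^ (p - 1 - 1)) else 0) := by
        rw [lintegral_const_mul' _ _ (by simp), mul_assoc]
    _ = ENNReal.ofReal p * 2 * ∫⁻ x in U, ∫⁻ τ in Set.Ioi (0:ℝ), 
        (if ENNReal.ofReal τ * Φ x < 2 * B * φ x then
          φ x * ENNReal.ofReal (τ ^ (p - 1 - 1)) else 0) := by
        congr 1
        apply lintegral_lintegral_swap
        apply Measurable.aemeasurable
        apply Measurable.ite
        · exact measurableSet_lt ((measurable_fst.ennreal_ofReal).mul (hΦ.comp measurable_snd))
            ((hφ.comp measurable_snd).const_mul _)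
        · exact (hφ.comp measurable_snd).mul ((hpow _).comp measurable_fst)
        · exact measurable_const
    _ ≤ ENNReal.ofReal p * 2 * ∫⁻ x in U, (ENNReal.ofReal (p - 1)⁻¹ * (2 * B) ^ (p - 1)) *
        (φ x ^ p * (Φ x)⁻¹ ^ (p - 1)) := by
        gcongr with x
        calc ∫⁻ τ in Set.Ioi (0:ℝ), (if ENNReal.ofReal τ * Φ x < 2 * B * φ x then
              φ x * ENNReal.ofReal (τ ^ (p - 1 - 1)) else 0)
            ≤ ∫⁻ τ in Set.Ioi (0:ℝ), φ x * (if ENNReal.ofReal τ < 2 * B * φ x * (Φ x)⁻¹ then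
              ENNReal.ofReal (τ ^ (p - 1 - 1)) else 0) := by
              apply setLIntegral_mono' measurableSet_Ioi
              intro τ hτ
              have hτ' : (0:ℝ) < τ := hτ
              split_ifs with h1 h2
              · exact le_rfl
              · exfalso
                apply h2
                rw [← div_eq_mul_inv]
                by_cases hΦ0 : Φ x = 0
                · rw [hΦ0, mul_zero] at h1
                  rw [hΦ0, ENNReal.div_zero h1.ne']
                  exact ENNReal.ofReal_lt_top
                · have hΦt : Φ x ≠ ∞ := by
                    intro ht
                    rw [ht, ENNReal.mul_top (by simpa using hτ')] at h1
                    exact absurd h1 not_top_lt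
                  rwa [ENNReal.lt_div_iff_mul_lt (Or.inl hΦ0) (Or.inl hΦt)]
              · exact zero_le
              · exact zero_le
          _ = φ x * ∫⁻ τ in Set.Ioi (0:ℝ), (if ENNReal.ofReal τ < 2 * B * φ x * (Φ x)⁻¹ then
              ENNReal.ofReal (τ ^ (p - 1 - 1)) else 0) := by
              rw [lintegral_const_mul]
              apply Measurable.ite
              · exact measurableSet_lt (measurable_id.ennreal_ofReal) measurable_const
              · exact hpow _
              · exact measurable_const
          _ = φ x * (ENNReal.ofReal (p - 1)⁻¹ * (2 * B * φ x * (Φ x)⁻¹) ^ (p - 1)) := by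
              congr 1
              rw [layer hp1, ← mul_assoc, ← ENNReal.ofReal_mul (by positivity),
                inv_mul_cancel₀ hp1.ne', ENNReal.ofReal_one, one_mul]
          _ = _ := by
              rw [ENNReal.mul_rpow_of_nonneg _ _ hp1.le, ENNReal.mul_rpow_of_nonneg _ _ hp1.le]
              have : φ x ^ p = φ x ^ (p - 1) * φ x := by
                conv_rhs => rw [← ENNReal.rpow_one (φ x)]
                rw [← ENNReal.rpow_mul, one_mul, ← ENNReal.rpow_add_of_nonneg _ _ hp1.le zero_le_one]
                congr 1; ring
              rw [this]; ring
    _ = _ := by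
        rw [lintegral_const_mul' _ _ (ENNReal.mul_ne_top ENNReal.ofReal_ne_top
          (ENNReal.rpow_ne_top_of_nonneg hp1.le (ENNReal.mul_ne_top (by simp) hB)))]
        ring

lemma fmax_rpow {d : ℕ} (𝓕 : Finset (Cube d)) (c : Cube d → ℝ≥0∞) (x : Fin d → ℝ) (a : ℝ)
    (ha : 0 < a) : (fmax 𝓕 c x) ^ a = fmax 𝓕 (fun Q => c Q ^ a) x := by
  unfold fmax
  have h : ∀ y : ℝ≥0∞, y ^ a = ENNReal.orderIsoRpow a ha y := fun y => rfl
  rw [h, OrderIso.map_iSup]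
  congr 1; ext Q
  rw [OrderIso.map_iSup]
  congr 1; ext hQ
  rw [← h]
  by_cases hx : x ∈ Q.set
  · simp [hx]
  · simp [hx, ha]

lemma le_fmax {d : ℕ} (𝓕 : Finset (Cube d)) (c : Cube d → ℝ≥0∞) (x : Fin d → ℝ) (Q : Cube d)
    (hQ : Q ∈ 𝓕) (hx : x ∈ Q.set) : c Q ≤ fmax 𝓕 c x := by
  unfold fmax
  refine le_trans ?_ (le_iSup₂ Q hQ)
  rw [Set.indicator_of_mem hx]

lemma fmax_le {d : ℕ} (𝓕 : Finset (Cube d)) (c : Cube d → ℝ≥0∞) (x : Fin d → ℝ) (b : ℝ≥0∞)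
    (h : ∀ Q ∈ 𝓕, x ∈ Q.set → c Q ≤ b) : fmax 𝓕 c x ≤ b := by
  unfold fmax
  refine iSup₂_le fun Q hQ => ?_
  by_cases hx : x ∈ Q.set
  · rw [Set.indicator_of_mem hx]; exact h Q hQ hx
  · rw [Set.indicator_of_notMem hx]; exact zero_le

lemma measurable_fmax2 {d : ℕ} {Ω : Type*} [MeasurableSpace Ω] (𝓕 : Finset (Cube d))
    (c : Cube d → Ω → ℝ≥0∞) (hc : ∀ Q, Measurable (c Q)) :
    Measurable (fun z : (Fin d → ℝ) × Ω => fmax 𝓕 (fun Q => c Q z.2) z.1) := by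
  unfold fmax
  apply Measurable.biSup _ 𝓕.countable_toSet
  intro Q _
  have : (fun z : (Fin d → ℝ) × Ω => Q.set.indicator (fun _ => c Q z.2) z.1) =
      (Prod.fst ⁻¹' Q.set).indicator (fun z => c Q z.2) := by
    funext z
    by_cases hz : z.1 ∈ Q.set
    · rw [Set.indicator_of_mem hz, Set.indicator_of_mem (show z ∈ Prod.fst ⁻¹' Q.set from hz)]
    · rw [Set.indicator_of_notMem hz,
        Set.indicator_of_notMem (show z ∉ Prod.fst ⁻¹' Q.set from hz)]
  rw [this]
  exact ((hc Q).comp measurable_snd).indicator (measurable_fst Q.meas)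

lemma avg_eq {d : ℕ} (r : ℝ≥0∞) (hr : r ≠ ∞) (F : (Fin d → ℝ) → ℝ≥0∞) (Q : Cube d) :
    avg r F Q = ((∫⁻ x in Q.set, F x ^ r.toReal) / volume Q.set) ^ (1 / r.toReal) := by
  simp [avg, hr, Cube.vol]

lemma measurable_avg {d : ℕ} {Ω : Type*} [MeasurableSpace Ω] (r : ℝ≥0∞) (hr : r ≠ ∞)
    (f : (Fin d → ℝ) → Ω → ℝ≥0∞) (hf : Measurable (Function.uncurry f)) (Q : Cube d) :
    Measurable (fun ω => avg r (fun x => f x ω) Q) := by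
  simp only [avg_eq r hr]
  apply Measurable.pow_const
  apply Measurable.div_const
  exact Measurable.lintegral_prod_left' (hf.pow_const r.toReal)

lemma avg_mono_ae {d : ℕ} (r : ℝ≥0∞) (hr : r ≠ ∞) (F G : (Fin d → ℝ) → ℝ≥0∞) (Q : Cube d)
    (h : ∀ᵐ x, F x ≤ G x) : avg r F Q ≤ avg r G Q := by
  rw [avg_eq r hr, avg_eq r hr]
  apply ENNReal.rpow_le_rpow _ (by positivity)
  apply ENNReal.div_le_div_right
  apply lintegral_mono_ae
  filter_upwards [ae_restrict_of_ae h] with x hx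
  exact ENNReal.rpow_le_rpow hx (by positivity)

lemma lintegral_le_of_avg_le {d : ℕ} (r : ℝ≥0∞) (hr0 : r ≠ 0) (hr : r ≠ ∞)
    (F : (Fin d → ℝ) → ℝ≥0∞) (Q : Cube d) (β : ℝ≥0∞) :
    avg r F Q ≤ β ↔ ∫⁻ x in Q.set, F x ^ r.toReal ≤ β ^ r.toReal * volume Q.set := by
  have h0 : 0 < r.toReal := ENNReal.toReal_pos hr0 hr
  rw [avg_eq r hr, one_div, ENNReal.rpow_inv_le_iff h0,
    ENNReal.div_le_iff Q.vol_ne_zero Q.vol_ne_top]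

lemma lt_avg_iff {d : ℕ} (r : ℝ≥0∞) (hr0 : r ≠ 0) (hr : r ≠ ∞)
    (F : (Fin d → ℝ) → ℝ≥0∞) (Q : Cube d) (β : ℝ≥0∞) :
    β < avg r F Q ↔ β ^ r.toReal * volume Q.set < ∫⁻ x in Q.set, F x ^ r.toReal := by
  rw [← not_le, lintegral_le_of_avg_le r hr0 hr, not_le]

lemma eNorm_top {α : Type*} [MeasurableSpace α] (μ : Measure α) (F : α → ℝ≥0∞) :
    eNorm ∞ μ F = essSup F μ := by simp [eNorm]

lemma eNorm_ne_top {α : Type*} [MeasurableSpace α] (p : ℝ≥0∞) (hp : p ≠ ∞) (μ : Measure α)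
    (F : α → ℝ≥0∞) : eNorm p μ F = (∫⁻ x, F x ^ p.toReal ∂μ) ^ (1 / p.toReal) := by
  simp [eNorm, hp]

lemma measurable_eNorm {X Ω : Type*} [MeasurableSpace X] [MeasurableSpace Ω] (t : ℝ≥0∞)
    (μ : Measure Ω) [SFinite μ] (f : X → Ω → ℝ≥0∞) (hf : Measurable (Function.uncurry f)) :
    Measurable (fun x => eNorm t μ (f x)) := by
  by_cases ht : t = ∞
  · subst ht
    simp only [eNorm_top]
    apply measurable_of_Ioi
    intro a
    have : (fun x => essSup (f x) μ) ⁻¹' Set.Ioi a =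
        {x | 0 < μ (Prod.mk x ⁻¹' {z : X × Ω | a < f z.1 z.2})} := by
      ext x
      simp only [Set.mem_preimage, Set.mem_Ioi, Set.mem_ofPred_eq]
      rw [← not_iff_not, not_lt, not_lt, nonpos_iff_eq_zero]
      constructor
      · intro h
        have h1 := ENNReal.ae_le_essSup (μ := μ) (f x)
        have h2 : ∀ᵐ ω ∂μ, ¬ (a < f x ω) := by
          filter_upwards [h1] with ω hω
          exact not_lt.2 (hω.trans h)
        rw [ae_iff] at h2
        simpa using h2
      · intro h
        refine essSup_le_of_ae_le a ?_
        rw [Filter.EventuallyLE, ae_iff]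
        simpa using h
    rw [this]
    have hm : MeasurableSet {z : X × Ω | a < f z.1 z.2} := measurableSet_lt measurable_const hf
    exact measurableSet_lt measurable_const (measurable_measure_prodMk_left hm)
  · simp only [eNorm_ne_top t ht]
    exact (Measurable.lintegral_prod_right' (hf.pow_const t.toReal)).pow_const _

lemma ae_zero_of_eNorm {Ω : Type*} [MeasurableSpace Ω] (t : ℝ≥0∞) (ht : t ≠ 0)
    (μ : Measure Ω) (f : Ω → ℝ≥0∞) (hf : Measurable f) (h : eNorm t μ f = 0) :
    ∀ᵐ ω ∂μ, f ω = 0 := by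
  by_cases htt : t = ∞
  · subst htt
    rw [eNorm_top] at h
    filter_upwards [ENNReal.ae_le_essSup (μ := μ) f] with ω hω
    rw [h] at hω
    exact le_antisymm hω zero_le
  · have h0 : 0 < t.toReal := ENNReal.toReal_pos ht htt
    rw [eNorm_ne_top t htt, ENNReal.rpow_eq_zero_iff_of_pos (by positivity),
      lintegral_eq_zero_iff (hf.pow_const _)] at h
    filter_upwards [h] with ω hω
    simpa [ENNReal.rpow_eq_zero_iff_of_pos h0] using hω

lemma perj (r : ℝ≥0∞) (hr0 : r ≠ 0) (hr : r ≠ ∞) (t : ℝ≥0∞) (hrt : r < t) :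
    ∃ C : ℝ≥0∞, C ≠ ∞ ∧ ∀ (d : ℕ) (Ω : Type) [MeasurableSpace Ω] (μ : Measure Ω) [SigmaFinite μ]
      (𝓕 : Finset (Cube d)) (_ : Laminar (𝓕 : Set (Cube d)))
      (f : (Fin d → ℝ) → Ω → ℝ≥0∞) (_ : Measurable (Function.uncurry f))
      (β : ℝ≥0∞) (_ : β ≠ 0) (_ : β ≠ ∞)
      (_ : ∀ Q ∈ 𝓕, avg r (fun x => eNorm t μ (f x)) Q ≤ β) (q : ℝ) (_ : 0 < q),
      ∃ Y : (Fin d → ℝ) × Ω → ℝ≥0∞, Measurable Y ∧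
        (∀ᵐ z ∂((volume : Measure (Fin d → ℝ)).prod μ),
          (fmax 𝓕 (fun Q => avg r (fun x => f x z.2) Q) z.1) ^ q
            ≤ β ^ q * Y z ^ (q * t⁻¹.toReal)) ∧
        (∫⁻ z, Y z ∂((volume : Measure (Fin d → ℝ)).prod μ)) ^ (q * t⁻¹.toReal) ≤
          (C * volume (⋃ Q ∈ 𝓕, Q.set)) ^ (q * t⁻¹.toReal) := by
  have hrr : 0 < r.toReal := ENNReal.toReal_pos hr0 hr
  by_cases ht : t = ∞
  · subst ht
    refine ⟨1, by simp, ?_⟩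
    intro d Ω _ μ _ 𝓕 lam f hf β hβ0 hβ hQ q hq
    refine ⟨fun _ => 1, measurable_const, ?_, by simp⟩
    have hF : Measurable (fun x => eNorm ∞ μ (f x)) := measurable_eNorm _ μ f hf
    have h1 : ∀ᵐ x ∂(volume : Measure (Fin d → ℝ)), ∀ᵐ ω ∂μ, f x ω ≤ eNorm ∞ μ (f x) := by
      refine Filter.Eventually.of_forall fun x => ?_
      rw [eNorm_top]
      exact ENNReal.ae_le_essSup (f x)
    have hms : MeasurableSet {z : (Fin d → ℝ) × Ω | f z.1 z.2 ≤ eNorm ∞ μ (f z.1)} :=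
      measurableSet_le hf (hF.comp measurable_fst)
    rw [Measure.ae_ae_comm (p := fun x ω => f x ω ≤ eNorm ∞ μ (f x)) hms] at h1
    have h2 := Measure.quasiMeasurePreserving_snd (μ := (volume : Measure (Fin d → ℝ))) (ν := μ)
      |>.ae h1
    filter_upwards [h2] with z hz
    simp only [ENNReal.one_rpow, mul_one]
    apply ENNReal.rpow_le_rpow _ hq.le
    apply fmax_le
    intro Q hQF _
    exact (avg_mono_ae r hr _ _ Q hz).trans (hQ Q hQF)
  · have ht0 : t ≠ 0 := (lt_of_le_of_lt zero_le hrt).ne'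
    have htr : 0 < t.toReal := ENNReal.toReal_pos ht0 ht
    have hlt : r.toReal < t.toReal := (ENNReal.toReal_lt_toReal hr ht).2 hrt
    set p := t.toReal / r.toReal with hp
    have hp1 : 1 < p := by rw [hp, one_lt_div hrr]; exact hlt
    have hp0 : 0 < p := by linarith
    have hrp : r.toReal * p = t.toReal := by rw [hp]; field_simp
    set K : ℝ≥0∞ := ENNReal.ofReal p * 2 * ENNReal.ofReal (p - 1)⁻¹ with hK
    have hKfin : K ≠ ∞ := ENNReal.mul_ne_top (ENNReal.mul_ne_top ENNReal.ofReal_ne_top (by simp))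
      ENNReal.ofReal_ne_top
    refine ⟨K * 2 ^ (p - 1), ENNReal.mul_ne_top hKfin
      (ENNReal.rpow_ne_top_of_nonneg (by linarith) (by simp)), ?_⟩
    intro d Ω _ μ _ 𝓕 lam f hf β hβ0 hβ hQ q hq
    set S : (Fin d → ℝ) × Ω → ℝ≥0∞ :=
      fun z => fmax 𝓕 (fun Q => avg r (fun x => f x z.2) Q) z.1 with hS
    have hSm : Measurable S := measurable_fmax2 𝓕 _ (fun Q => measurable_avg r hr f hf Q)
    have hF : Measurable (fun x => eNorm t μ (f x)) := measurable_eNorm _ μ f hf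
    set U := ⋃ Q ∈ 𝓕, Q.set with hU
    have hUm : MeasurableSet U := Finset.measurableSet_biUnion _ fun Q _ => Q.meas
    set Φ : (Fin d → ℝ) → ℝ≥0∞ := fun x => eNorm t μ (f x) ^ r.toReal with hΦ
    have hΦm : Measurable Φ := hF.pow_const _
    set B := β ^ r.toReal with hB
    have hB0 : B ≠ 0 := by
      rw [hB, Ne, ENNReal.rpow_eq_zero_iff_of_pos hrr]; exact hβ0
    have hBt : B ≠ ∞ := ENNReal.rpow_ne_top_of_nonneg hrr.le hβ
    have hΦB : ∀ Q ∈ 𝓕, ∫⁻ x in Q.set, Φ x ≤ B * volume Q.set := fun Q hQF =>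
      (lintegral_le_of_avg_le r hr0 hr _ Q β).1 (hQ Q hQF)
    have hΦU : ∫⁻ x in U, Φ x ≤ B * volume U := by
      have := laminar_cubes (volume.withDensity Φ) (B • volume) 𝓕 lam (by
        intro Q hQF
        rw [withDensity_apply _ Q.meas]
        simpa using hΦB Q hQF)
      rw [withDensity_apply _ hUm] at this
      simpa using this
    have hfix : ∀ ω, ∫⁻ x, S (x, ω) ^ t.toReal ≤ K * (2 * B) ^ (p - 1) *
        ∫⁻ x in U, f x ω ^ t.toReal * (Φ x)⁻¹ ^ (p - 1) := by
      intro ω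
      have hfω : Measurable (fun x => f x ω) := hf.comp measurable_prodMk_right
      have := max_lemma 𝓕 lam (fun x => f x ω ^ r.toReal) Φ (hfω.pow_const _) hΦm B hB0 hBt hΦB p hp1
      simp only [← ENNReal.rpow_mul, hrp] at this
      refine le_trans (le_of_eq ?_) this
      apply lintegral_congr; intro x
      simp only [hS]
      rw [fmax_rpow _ _ _ _ htr, fmax_rpow _ _ _ _ hp0]
      congr 1; ext Q
      rw [avg_eq r hr, ← ENNReal.rpow_mul]
      congr 1
      rw [hp]; ring
    have h_int : ∫⁻ z, S z ^ t.toReal ∂((volume : Measure (Fin d → ℝ)).prod μ) ≤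
        K * 2 ^ (p - 1) * β ^ t.toReal * volume U := by
      rw [lintegral_prod_symm _ (hSm.pow_const _).aemeasurable]
      calc _ ≤ ∫⁻ ω, K * (2 * B) ^ (p - 1) *
            (∫⁻ x in U, f x ω ^ t.toReal * (Φ x)⁻¹ ^ (p - 1)) ∂μ := lintegral_mono hfix
        _ = K * (2 * B) ^ (p - 1) * ∫⁻ ω, 
            (∫⁻ x in U, f x ω ^ t.toReal * (Φ x)⁻¹ ^ (p - 1)) ∂μ := by
            rw [lintegral_const_mul' _ _ (ENNReal.mul_ne_top hKfin
              (ENNReal.rpow_ne_top_of_nonneg (by linarith) (ENNReal.mul_ne_top (by simp) hBt)))]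
        _ = K * (2 * B) ^ (p - 1) * ∫⁻ x in U, (∫⁻ ω,
            f x ω ^ t.toReal * (Φ x)⁻¹ ^ (p - 1) ∂μ) := by
            congr 1
            apply lintegral_lintegral_swap
            apply Measurable.aemeasurable
            exact ((hf.comp measurable_swap).pow_const _).mul
              ((hΦm.inv.pow_const _).comp measurable_snd)
        _ ≤ K * (2 * B) ^ (p - 1) * ∫⁻ x in U, Φ x := by
            gcongr with x
            have hfx : Measurable (f x) := hf.comp measurable_prodMk_left
            rw [lintegral_mul_const _ (hfx.pow_const _)]
            have h1 : ∫⁻ ω, f x ω ^ t.toReal ∂μ = Φ x ^ p := by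
              simp only [hΦ]
              rw [← ENNReal.rpow_mul, hrp, eNorm_ne_top t ht, ← ENNReal.rpow_mul,
                one_div_mul_cancel htr.ne', ENNReal.rpow_one]
            rw [h1]
            have h2 : Φ x ^ p = Φ x * Φ x ^ (p - 1) := by
              conv_rhs => enter [1]; rw [← ENNReal.rpow_one (Φ x)]
              rw [← ENNReal.rpow_add_of_nonneg _ _ zero_le_one (by linarith)]
              congr 1; ring
            rw [h2, mul_assoc, ← ENNReal.mul_rpow_of_nonneg _ _ (by linarith : (0:ℝ) ≤ p - 1)]
            calc _ ≤ Φ x * 1 ^ (p - 1) := by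
                  apply mul_le_mul_right
                  exact ENNReal.rpow_le_rpow (ENNReal.mul_inv_le_one (Φ x)) (by linarith)
              _ = Φ x := by simp
        _ ≤ K * (2 * B) ^ (p - 1) * (B * volume U) := by gcongr
        _ = K * 2 ^ (p - 1) * (B ^ (p - 1) * B ^ (1:ℝ)) * volume U := by
            rw [ENNReal.mul_rpow_of_nonneg _ _ (by linarith : (0:ℝ) ≤ p - 1), ENNReal.rpow_one]
            ring
        _ = _ := by
            rw [← ENNReal.rpow_add_of_nonneg _ _ (by linarith) zero_le_one, hB,
              ← ENNReal.rpow_mul, sub_add_cancel, hrp]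
    refine ⟨fun z => (S z / β) ^ t.toReal, (hSm.div_const _).pow_const _, ?_, ?_⟩
    · refine Filter.Eventually.of_forall fun z => ?_
      change S z ^ q ≤ _
      rw [← ENNReal.rpow_mul, ENNReal.toReal_inv]
      have : t.toReal * (q * t.toReal⁻¹) = q := by field_simp
      rw [this, ← ENNReal.mul_rpow_of_nonneg _ _ hq.le, ENNReal.mul_div_cancel hβ0 hβ]
    · apply ENNReal.rpow_le_rpow _ (by positivity)
      have hβt0 : β ^ t.toReal ≠ 0 := by
        rw [Ne, ENNReal.rpow_eq_zero_iff_of_pos htr]; exact hβ0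
      have hβt : β ^ t.toReal ≠ ∞ := ENNReal.rpow_ne_top_of_nonneg htr.le hβ
      simp only [ENNReal.div_rpow_of_nonneg _ _ htr.le]
      simp only [div_eq_mul_inv]
      rw [lintegral_mul_const _ (hSm.pow_const _), ← div_eq_mul_inv, ENNReal.div_le_iff hβt0 hβt]
      refine h_int.trans (le_of_eq ?_)
      ring

lemma ennreal_rpow_sum {ι : Type*} (s : Finset ι) (x : ℝ≥0∞) (θ : ι → ℝ) (hθ : ∀ i, 0 ≤ θ i) :
    ∏ i ∈ s, x ^ θ i = x ^ (∑ i ∈ s, θ i) := by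
  classical
  induction s using Finset.induction_on with
  | empty => simp
  | insert a s ha ih =>
    rw [Finset.prod_insert ha, Finset.sum_insert ha, ih,
      ENNReal.rpow_add_of_nonneg _ _ (hθ a) (Finset.sum_nonneg fun i _ => hθ i)]

lemma ennreal_prod_rpow {ι : Type*} (s : Finset ι) (x : ι → ℝ≥0∞) (q : ℝ) (hq : 0 ≤ q) :
    (∏ i ∈ s, x i) ^ q = ∏ i ∈ s, x i ^ q := by
  classical
  induction s using Finset.induction_on with
  | empty => simp
  | insert a s ha ih =>
    rw [Finset.prod_insert ha, Finset.prod_insert ha, ENNReal.mul_rpow_of_nonneg _ _ hq, ih]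

lemma holder_class {ι : Type*} [Fintype ι] (r t : ι → ℝ≥0∞) (hr0 : ∀ j, r j ≠ 0)
    (hr : ∀ j, r j ≠ ∞) (hrt : ∀ j, r j < t j) (q : ℝ) (hq : 0 < q)
    (hsum : ∑ j, q * (t j)⁻¹.toReal = 1) :
    ∃ C : ℝ≥0∞, C ≠ ∞ ∧ ∀ (d : ℕ) (Ω : Type) [MeasurableSpace Ω] (μ : Measure Ω) [SigmaFinite μ]
      (𝓕 : Finset (Cube d)) (_ : Laminar (𝓕 : Set (Cube d)))
      (f : ι → (Fin d → ℝ) → Ω → ℝ≥0∞) (_ : ∀ j, Measurable (Function.uncurry (f j)))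
      (β : ι → ℝ≥0∞) (_ : ∀ j, β j ≠ 0) (_ : ∀ j, β j ≠ ∞)
      (_ : ∀ Q ∈ 𝓕, ∀ j, avg (r j) (fun x => eNorm (t j) μ (f j x)) Q ≤ β j),
      ∫⁻ z, (fmax 𝓕 (fun Q => ∏ j, avg (r j) (fun x => f j x z.2) Q) z.1) ^ q
          ∂((volume : Measure (Fin d → ℝ)).prod μ) ≤
        C * (∏ j, β j) ^ q * volume (⋃ Q ∈ 𝓕, Q.set) := by
  choose C hC hmain using fun j => perj (r j) (hr0 j) (hr j) (t j) (hrt j)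
  have hθ : ∀ j, 0 ≤ q * (t j)⁻¹.toReal := fun j => by positivity
  refine ⟨∏ j, C j ^ (q * (t j)⁻¹.toReal), ?_, ?_⟩
  · exact ENNReal.prod_ne_top fun j _ => ENNReal.rpow_ne_top_of_nonneg (hθ j) (hC j)
  intro d Ω _ μ _ 𝓕 lam f hf β hβ0 hβ hQ
  choose Y hYm hY1 hY2 using fun j => hmain j d Ω μ 𝓕 lam (f j) (hf j) (β j) (hβ0 j) (hβ j)
    (fun Q h => hQ Q h j) q hq
  calc _ ≤ ∫⁻ z, (∏ j, β j) ^ q * ∏ j, Y j z ^ (q * (t j)⁻¹.toReal)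
          ∂((volume : Measure (Fin d → ℝ)).prod μ) := by
        apply lintegral_mono_ae
        filter_upwards [ae_all_iff.2 hY1] with z hz
        calc _ ≤ (∏ j, fmax 𝓕 (fun Q => avg (r j) (fun x => f j x z.2) Q) z.1) ^ q := by
              apply ENNReal.rpow_le_rpow _ hq.le
              apply fmax_le
              intro Q hQF hx
              apply Finset.prod_le_prod' 
              intro j _
              exact le_fmax 𝓕 (fun Q => avg (r j) (fun x => f j x z.2) Q) z.1 Q hQF hx
          _ ≤ ∏ j, (β j ^ q * Y j z ^ (q * (t j)⁻¹.toReal)) := by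
              rw [ennreal_prod_rpow _ _ _ hq.le]
              exact Finset.prod_le_prod' fun j _ => hz j
          _ = _ := by
              rw [Finset.prod_mul_distrib, ennreal_prod_rpow _ _ _ hq.le]
    _ = (∏ j, β j) ^ q * ∫⁻ z, ∏ j, Y j z ^ (q * (t j)⁻¹.toReal)
          ∂((volume : Measure (Fin d → ℝ)).prod μ) := by
        rw [lintegral_const_mul']
        exact ENNReal.rpow_ne_top_of_nonneg hq.le (ENNReal.prod_ne_top fun j _ => hβ j)
    _ ≤ (∏ j, β j) ^ q * ∏ j, (∫⁻ z, Y j z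
          ∂((volume : Measure (Fin d → ℝ)).prod μ)) ^ (q * (t j)⁻¹.toReal) := by
        gcongr
        exact ENNReal.lintegral_prod_norm_pow_le _ (fun j _ => (hYm j).aemeasurable) hsum
          (fun j _ => hθ j)
    _ ≤ (∏ j, β j) ^ q * ∏ j, (C j * volume (⋃ Q ∈ 𝓕, Q.set)) ^ (q * (t j)⁻¹.toReal) := by
        apply mul_le_mul_right
        exact Finset.prod_le_prod' fun j _ => hY2 j
    _ = _ := by
        have : ∀ j, (C j * volume (⋃ Q ∈ 𝓕, Q.set)) ^ (q * (t j)⁻¹.toReal) =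
          C j ^ (q * (t j)⁻¹.toReal) * (volume (⋃ Q ∈ 𝓕, Q.set)) ^ (q * (t j)⁻¹.toReal) :=
          fun j => ENNReal.mul_rpow_of_nonneg _ _ (hθ j)
        simp only [this]
        rw [Finset.prod_mul_distrib, ennreal_rpow_sum _ _ _ hθ, hsum, ENNReal.rpow_one]
        ring

lemma vol_biUnion_ne_top {d : ℕ} (𝓕 : Finset (Cube d)) :
    volume (⋃ Q ∈ 𝓕, Q.set) ≠ ∞ := by
  refine ne_top_of_le_ne_top ?_ (measure_biUnion_finset_le 𝓕 _)
  exact ENNReal.sum_ne_top.2 fun Q _ => Q.vol_ne_top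

lemma density_cmp {d : ℕ} (r : ℝ≥0∞) (hr0 : r ≠ 0) (hr : r ≠ ∞) (F : (Fin d → ℝ) → ℝ≥0∞)
    (𝓑 𝓤 : Finset (Cube d)) (lB : Laminar (𝓑 : Set (Cube d))) (lU : Laminar (𝓤 : Set (Cube d)))
    (a b : ℝ≥0∞) (ha : ∀ Q ∈ 𝓑, a < avg r F Q) (hb : ∀ Q ∈ 𝓤, avg r F Q ≤ b)
    (hsub : (⋃ Q ∈ 𝓑, Q.set) ⊆ ⋃ Q ∈ 𝓤, Q.set) :
    a ^ r.toReal * volume (⋃ Q ∈ 𝓑, Q.set) ≤ b ^ r.toReal * volume (⋃ Q ∈ 𝓤, Q.set) := by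
  have h1 := laminar_cubes (a ^ r.toReal • volume) (volume.withDensity (fun x => F x ^ r.toReal))
    𝓑 lB (fun Q hQ => by
      rw [withDensity_apply _ Q.meas, Measure.smul_apply, smul_eq_mul]
      exact ((lt_avg_iff _ hr0 hr _ _ _).1 (ha Q hQ)).le)
  have h3 := laminar_cubes (volume.withDensity (fun x => F x ^ r.toReal)) (b ^ r.toReal • volume)
    𝓤 lU (fun Q hQ => by
      rw [withDensity_apply _ Q.meas, Measure.smul_apply, smul_eq_mul]
      exact (lintegral_le_of_avg_le _ hr0 hr _ _ _).1 (hb Q hQ))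
  rw [Measure.smul_apply, smul_eq_mul] at h1 h3
  exact h1.trans ((measure_mono hsub).trans h3)

open Classical in
lemma counting {d : ℕ} {ι : Type*} [Fintype ι] [Nonempty ι] (r : ι → ℝ≥0∞) (hr0 : ∀ j, r j ≠ 0)
    (hr : ∀ j, r j ≠ ∞) (A : ℝ≥0∞) (hA0 : A ≠ 0) (hAt : A ≠ ∞)
    (hA : ∀ j, 2 * (Fintype.card ι : ℝ≥0∞) ≤ A ^ (r j).toReal)
    (hA1 : 1 ≤ A)
    (F : ι → (Fin d → ℝ) → ℝ≥0∞)
    (D : Finset (Cube d)) (lam : Laminar (D : Set (Cube d))) (k : Cube d → ι → ℤ)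
    (hk : ∀ Q ∈ D, ∀ j, A ^ (k Q j) < avg (r j) (F j) Q ∧ avg (r j) (F j) Q ≤ A ^ (k Q j + 1))
    (𝒦 : Finset (ι → ℤ)) (h𝒦 : ∀ κ ∈ 𝒦, ∀ κ' ∈ 𝒦, κ ≠ κ' → ∃ j, κ j + 2 ≤ κ' j) :
    ∑ κ ∈ 𝒦, volume (⋃ Q ∈ D.filter (fun Q => k Q = κ), Q.set) ≤
      2 * volume (⋃ κ ∈ 𝒦, ⋃ Q ∈ D.filter (fun Q => k Q = κ), Q.set) := by
  set U : (ι → ℤ) → Set (Fin d → ℝ) := fun κ => ⋃ Q ∈ D.filter (fun Q => k Q = κ), Q.set with hU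
  have hUm : ∀ κ, MeasurableSet (U κ) := fun κ =>
    Finset.measurableSet_biUnion _ fun Q _ => Q.meas
  set 𝓑 : (ι → ℤ) → ι → Finset (Cube d) := fun κ j =>
    D.filter (fun Q' => κ j + 2 ≤ k Q' j ∧ ∃ Q ∈ D, k Q = κ ∧ Q'.set ⊆ Q.set) with h𝓑
  set B : (ι → ℤ) → Set (Fin d → ℝ) := fun κ => ⋃ j, ⋃ Q ∈ 𝓑 κ j, Q.set with hB
  have hBm : ∀ κ, MeasurableSet (B κ) := fun κ =>
    MeasurableSet.iUnion fun j => Finset.measurableSet_biUnion _ fun Q _ => Q.meas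
  have hUfin : ∀ κ, volume (U κ) ≠ ∞ := fun κ => vol_biUnion_ne_top _
  have hlamf : ∀ 𝓖 : Finset (Cube d), 𝓖 ⊆ D → Laminar (𝓖 : Set (Cube d)) :=
    fun 𝓖 h a ha b hb => lam a (h ha) b (h hb)
  have hBj : ∀ κ j, 2 * (Fintype.card ι : ℝ≥0∞) * volume (⋃ Q ∈ 𝓑 κ j, Q.set) ≤ volume (U κ) := by
    intro κ j
    have hrj0 : 0 < (r j).toReal := ENNReal.toReal_pos (hr0 j) (hr j)
    have h5 := density_cmp (r j) (hr0 j) (hr j) (F j) (𝓑 κ j) (D.filter (fun Q => k Q = κ))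
      (hlamf _ (Finset.filter_subset _ _)) (hlamf _ (Finset.filter_subset _ _))
      (A ^ (κ j + 2)) (A ^ (κ j + 1))
      (by
        intro Q hQ
        obtain ⟨hQD, hQ1, _⟩ := Finset.mem_filter.1 hQ
        exact lt_of_le_of_lt (ENNReal.zpow_le_of_le hA1 hQ1) (hk Q hQD j).1)
      (by
        intro Q hQ
        obtain ⟨hQD, hQ1⟩ := Finset.mem_filter.1 hQ
        have := (hk Q hQD j).2
        rwa [hQ1] at this)
      (by
        intro x hx
        obtain ⟨Q', hQ', hx⟩ := Set.mem_iUnion₂.1 hx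
        obtain ⟨_, _, Q, hQD, hQκ, hsub⟩ := Finset.mem_filter.1 hQ'
        exact Set.mem_iUnion₂.2 ⟨Q, Finset.mem_filter.2 ⟨hQD, hQκ⟩, hsub hx⟩)
    have h4 : (A ^ (κ j + 2)) ^ (r j).toReal = (A ^ (κ j + 1)) ^ (r j).toReal * A ^ (r j).toReal := by
      rw [← ENNReal.mul_rpow_of_nonneg _ _ hrj0.le]
      congr 1
      rw [show κ j + 2 = (κ j + 1) + 1 by ring, ENNReal.zpow_add hA0 hAt, zpow_one]
    rw [h4, mul_assoc] at h5
    have hz : A ^ (κ j + 1) ≠ 0 := (ENNReal.zpow_pos hA0 hAt _).ne'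
    have hz' : A ^ (κ j + 1) ≠ ∞ := (ENNReal.zpow_lt_top hA0 hAt _).ne
    rw [ENNReal.mul_le_mul_iff_right (by
      rw [Ne, ENNReal.rpow_eq_zero_iff_of_pos hrj0]; exact hz)
      (ENNReal.rpow_ne_top_of_nonneg hrj0.le hz')] at h5
    refine le_trans ?_ h5
    gcongr
    exact hA j
  have hBU : ∀ κ, 2 * volume (B κ) ≤ volume (U κ) := by
    intro κ
    have hn0 : (Fintype.card ι : ℝ≥0∞) ≠ 0 := by simp
    have hnt : (Fintype.card ι : ℝ≥0∞) ≠ ∞ := by simp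
    rw [← ENNReal.mul_le_mul_iff_right hn0 hnt]
    calc (Fintype.card ι : ℝ≥0∞) * (2 * volume (B κ))
        ≤ (Fintype.card ι : ℝ≥0∞) * (2 * ∑ j, volume (⋃ Q ∈ 𝓑 κ j, Q.set)) := by
          gcongr
          exact measure_iUnion_fintype_le _ _
      _ = ∑ j, 2 * (Fintype.card ι : ℝ≥0∞) * volume (⋃ Q ∈ 𝓑 κ j, Q.set) := by
          rw [← Finset.mul_sum]; ring
      _ ≤ ∑ _j : ι, volume (U κ) := Finset.sum_le_sum fun j _ => hBj κ j
      _ = _ := by simp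
  have hE : ∀ κ, volume (U κ) ≤ 2 * volume (U κ \ B κ) := by
    intro κ
    have h1 : volume (U κ) ≤ volume (U κ \ B κ) + volume (B κ) := by
      refine (measure_mono ?_).trans (measure_union_le _ _)
      intro x hx
      by_cases hxB : x ∈ B κ
      · exact Or.inr hxB
      · exact Or.inl ⟨hx, hxB⟩
    have h2 : volume (U κ) + volume (U κ) ≤ 2 * volume (U κ \ B κ) + volume (U κ) := by
      calc volume (U κ) + volume (U κ) ≤ (volume (U κ \ B κ) + volume (B κ)) +
            (volume (U κ \ B κ) + volume (B κ)) := add_le_add h1 h1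
        _ = 2 * volume (U κ \ B κ) + 2 * volume (B κ) := by ring
        _ ≤ _ := by gcongr; exact hBU κ
    exact (ENNReal.add_le_add_iff_right (hUfin κ)).1 h2
  have hdisj : (𝒦 : Set (ι → ℤ)).PairwiseDisjoint (fun κ => U κ \ B κ) := by
    have key : ∀ κ ∈ 𝒦, ∀ κ' ∈ 𝒦, κ ≠ κ' → ∀ Q ∈ D, ∀ Q' ∈ D, k Q = κ → k Q' = κ' →
        Q'.set ⊆ Q.set → ∀ x ∈ Q'.set, x ∈ B κ := by
      intro κ hκ κ' hκ' hne Q hQ Q' hQ' hkQ hkQ' hsub x hx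
      obtain ⟨j, hj⟩ := h𝒦 κ hκ κ' hκ' hne
      simp only [hB, h𝓑, Set.mem_iUnion, Finset.mem_filter, exists_prop]
      exact ⟨j, Q', ⟨hQ', by rw [hkQ']; exact hj, Q, hQ, hkQ, hsub⟩, hx⟩
    intro κ hκ κ' hκ' hne
    rw [Function.onFun, Set.disjoint_left]
    rintro x ⟨hxU, hxB⟩ ⟨hxU', hxB'⟩
    simp only [hU, Set.mem_iUnion, Finset.mem_filter, exists_prop] at hxU hxU'
    obtain ⟨Q, ⟨hQ, hkQ⟩, hxQ⟩ := hxU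
    obtain ⟨Q', ⟨hQ', hkQ'⟩, hxQ'⟩ := hxU'
    rcases lam Q hQ Q' hQ' with h | h | h
    · exact hxB' (key κ' hκ' κ hκ hne.symm Q' hQ' Q hQ hkQ' hkQ h x hxQ)
    · exact hxB (key κ hκ κ' hκ' hne Q hQ Q' hQ' hkQ hkQ' h x hxQ')
    · exact Set.disjoint_left.1 h hxQ hxQ'
  calc ∑ κ ∈ 𝒦, volume (U κ) ≤ ∑ κ ∈ 𝒦, 2 * volume (U κ \ B κ) :=
        Finset.sum_le_sum fun κ _ => hE κ
    _ = 2 * volume (⋃ κ ∈ 𝒦, U κ \ B κ) := by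
        rw [← Finset.mul_sum, measure_biUnion_finset hdisj fun κ _ => (hUm κ).diff (hBm κ)]
    _ ≤ _ := by
        gcongr
        exact Set.diff_subset

lemma geom_sum_le (b : ℝ≥0∞) (hb : 2 ≤ b) (hbt : b ≠ ∞) (Z : Finset ℤ) :
    ∀ K₀ : ℤ, (∀ K ∈ Z, K ≤ K₀) → ∑ K ∈ Z, b ^ K ≤ 2 * b ^ K₀ := by
  have hb0 : b ≠ 0 := (lt_of_lt_of_le (by simp) hb).ne'
  have hb1 : 1 ≤ b := le_trans (by norm_num) hb
  induction Z using Finset.induction_on_max with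
  | empty => intro K₀ _; simp
  | insert a s hs ih =>
    intro K₀ hK
    rw [Finset.sum_insert (fun h => lt_irrefl _ (hs a h))]
    have h1 := ih (a - 1) (fun K hKs => by have := hs K hKs; omega)
    have h2 : b ^ a = b * b ^ (a - 1) := by
      conv_lhs => rw [show a = 1 + (a - 1) by ring]
      rw [ENNReal.zpow_add hb0 hbt, zpow_one]
    calc b ^ a + ∑ K ∈ s, b ^ K ≤ b ^ a + 2 * b ^ (a - 1) := by gcongr
      _ ≤ b ^ a + b * b ^ (a - 1) := by gcongr
      _ = 2 * b ^ a := by rw [← h2]; ring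
      _ ≤ 2 * b ^ K₀ := by
        gcongr 2 * ?_
        exact ENNReal.zpow_le_of_le hb1 (hK a (Finset.mem_insert_self _ _))

lemma zpow_rpow (A : ℝ≥0∞) (q : ℝ) (K : ℤ) : (A ^ K) ^ q = (A ^ q) ^ K := by
  rw [← ENNReal.rpow_intCast, ← ENNReal.rpow_intCast, ← ENNReal.rpow_mul, ← ENNReal.rpow_mul,
    mul_comm]

lemma geom_level (A : ℝ≥0∞) (hAt : A ≠ ∞) (q : ℝ) (hq : 0 < q) (hAq : 2 ≤ A ^ q) (Z : Finset ℤ)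
    (y : ℝ≥0∞) : ∑ K ∈ Z, (if A ^ K ≤ y then (A ^ K) ^ q else 0) ≤ 2 * y ^ q := by
  classical
  rw [← Finset.sum_filter]
  set W := Z.filter (fun K => A ^ K ≤ y) with hW
  by_cases hne : W.Nonempty
  · have hmem := Finset.max'_mem W hne
    have h1 := geom_sum_le (A ^ q) hAq (ENNReal.rpow_ne_top_of_nonneg hq.le hAt) W (W.max' hne)
      (fun K hK => Finset.le_max' W K hK)
    simp only [zpow_rpow]
    refine h1.trans ?_
    rw [← zpow_rpow]
    gcongr
    exact (Finset.mem_filter.1 hmem).2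
  · rw [Finset.not_nonempty_iff_eq_empty] at hne
    rw [hne]; simp

lemma exists_A {ι : Type*} [Fintype ι] [Nonempty ι] (r : ι → ℝ≥0∞) (hr0 : ∀ j, r j ≠ 0)
    (hr : ∀ j, r j ≠ ∞) (q : ℝ) (hq : 0 < q) :
    ∃ A : ℝ≥0∞, 1 < A ∧ A ≠ ∞ ∧ 2 ≤ A ^ q ∧
      ∀ j, 2 * (Fintype.card ι : ℝ≥0∞) ≤ A ^ (r j).toReal := by
  have hc : (1 : ℝ≥0∞) ≤ (Fintype.card ι : ℝ≥0∞) := by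
    exact_mod_cast Fintype.card_pos
  set N : ℝ≥0∞ := 2 * (Fintype.card ι : ℝ≥0∞) with hN
  have hN2 : 2 ≤ N := by
    calc (2 : ℝ≥0∞) = 2 * 1 := by ring
      _ ≤ N := by rw [hN]; gcongr
  have hN1 : 1 < N := lt_of_lt_of_le (by norm_num) hN2
  have hNt : N ≠ ∞ := ENNReal.mul_ne_top (by norm_num) (by simp)
  have hrp : ∀ j, 0 < (r j).toReal := fun j => ENNReal.toReal_pos (hr0 j) (hr j)
  set M : ℝ := 1 / q + ∑ j, 1 / (r j).toReal with hM
  have hs : 0 ≤ ∑ j, 1 / (r j).toReal := Finset.sum_nonneg fun j _ => by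
    have := hrp j; positivity
  have hMpos : 0 < M := by positivity
  have key : ∀ p : ℝ, 0 < p → 1 / p ≤ M → N ≤ (N ^ M) ^ p := by
    intro p hp hpM
    rw [← ENNReal.rpow_mul]
    conv_lhs => rw [← ENNReal.rpow_one N]
    apply ENNReal.rpow_le_rpow_of_exponent_le hN1.le
    rwa [div_le_iff₀ hp] at hpM
  refine ⟨N ^ M, ENNReal.one_lt_rpow hN1 hMpos, ENNReal.rpow_ne_top_of_nonneg hMpos.le hNt,
    hN2.trans (key q hq (by linarith)), fun j => key _ (hrp j) ?_⟩
  have : 1 / (r j).toReal ≤ ∑ j, 1 / (r j).toReal :=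
    Finset.single_le_sum (f := fun j => 1 / (r j).toReal)
      (fun i _ => by have := hrp i; positivity) (Finset.mem_univ j)
  have h2 : 0 < 1 / q := by positivity
  linarith

lemma prod_zpow_sum {ι : Type*} (s : Finset ι) (A : ℝ≥0∞) (hA0 : A ≠ 0) (hAt : A ≠ ∞)
    (κ : ι → ℤ) : ∏ j ∈ s, A ^ (κ j) = A ^ (∑ j ∈ s, κ j) := by
  classical
  induction s using Finset.induction_on with
  | empty => simp
  | insert a s ha ih =>
    rw [Finset.prod_insert ha, Finset.sum_insert ha, ih, ENNReal.zpow_add hA0 hAt]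

lemma parity_gap {ι : Type*} [Fintype ι] (κ κ' : ι → ℤ) (hs : ∑ j, κ j = ∑ j, κ' j)
    (hp : (fun j => decide (κ j % 2 = 0)) = (fun j => decide (κ' j % 2 = 0))) (hne : κ ≠ κ') :
    ∃ j, κ j + 2 ≤ κ' j := by
  by_contra! h
  apply hne
  have hle : ∀ j ∈ (Finset.univ : Finset ι), κ' j ≤ κ j := by
    intro j _
    have h1 := h j
    have h2 := congrFun hp j
    simp only [decide_eq_decide] at h2
    omega
  have := (Finset.sum_eq_sum_iff_of_le hle).1 hs.symm
  funext j
  exact (this j (Finset.mem_univ j)).symm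

open Classical in
lemma level_sum {d : ℕ} {ι : Type*} [Fintype ι] [Nonempty ι] (r : ι → ℝ≥0∞) (hr0 : ∀ j, r j ≠ 0)
    (hr : ∀ j, r j ≠ ∞) (A : ℝ≥0∞) (hA1 : 1 < A) (hAt : A ≠ ∞)
    (hA : ∀ j, 2 * (Fintype.card ι : ℝ≥0∞) ≤ A ^ (r j).toReal)
    (q : ℝ) (hq : 0 < q) (hAq : 2 ≤ A ^ q)
    (F : ι → (Fin d → ℝ) → ℝ≥0∞)
    (D : Finset (Cube d)) (lam : Laminar (D : Set (Cube d))) (k : Cube d → ι → ℤ)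
    (hk : ∀ Q ∈ D, ∀ j, A ^ (k Q j) < avg (r j) (F j) Q ∧ avg (r j) (F j) Q ≤ A ^ (k Q j + 1))
    (S : Finset (ι → ℤ)) :
    ∑ κ ∈ S, (A ^ (∑ j, κ j)) ^ q * volume (⋃ Q ∈ D.filter (fun Q => k Q = κ), Q.set) ≤
      4 * (Fintype.card (ι → Bool) : ℝ≥0∞) *
        ∫⁻ x, (fmax D (fun Q => ∏ j, avg (r j) (F j) Q) x) ^ q := by
  have hA0 : A ≠ 0 := (lt_trans (by simp) hA1).ne'
  let H : (Fin d → ℝ) → ℝ≥0∞ := fmax D (fun Q => ∏ j, avg (r j) (F j) Q)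
  have hH : Measurable H := measurable_fmax _ _
  let Z : Finset ℤ := S.image (fun κ => ∑ j, κ j)
  let g : (ι → ℤ) → ℤ × (ι → Bool) := fun κ => (∑ j, κ j, fun j => decide (κ j % 2 = 0))
  have hg : ∀ κ ∈ S, g κ ∈ Z ×ˢ (Finset.univ : Finset (ι → Bool)) := by
    intro κ hκ
    rw [Finset.mem_product]
    exact ⟨Finset.mem_image_of_mem _ hκ, Finset.mem_univ _⟩
  rw [← Finset.sum_fiberwise_of_maps_to hg]
  have hin : ∀ p ∈ Z ×ˢ (Finset.univ : Finset (ι → Bool)),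
      ∑ κ ∈ S with g κ = p, (A ^ (∑ j, κ j)) ^ q *
        volume (⋃ Q ∈ D.filter (fun Q => k Q = κ), Q.set) ≤
      2 * ((A ^ p.1) ^ q * volume {x | A ^ p.1 ≤ H x}) := by
    rintro ⟨K, p⟩ _
    have h1 : ∑ κ ∈ S with g κ = (K, p), (A ^ (∑ j, κ j)) ^ q *
        volume (⋃ Q ∈ D.filter (fun Q => k Q = κ), Q.set) =
        (A ^ K) ^ q * ∑ κ ∈ S with g κ = (K, p),
          volume (⋃ Q ∈ D.filter (fun Q => k Q = κ), Q.set) := by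
      rw [Finset.mul_sum]
      apply Finset.sum_congr rfl
      intro κ hκ
      have := (Finset.mem_filter.1 hκ).2
      have h2 : ∑ j, κ j = K := congrArg Prod.fst this
      rw [h2]
    rw [h1]
    have h2 := counting r hr0 hr A hA0 hAt hA hA1.le F D lam k hk (S.filter (fun κ => g κ = (K, p)))
      (by
        intro κ hκ κ' hκ' hne
        have e := ((Finset.mem_filter.1 hκ).2).trans ((Finset.mem_filter.1 hκ').2).symm
        exact parity_gap κ κ' (congrArg Prod.fst e) (congrArg Prod.snd e) hne)
    have h3 : (⋃ κ ∈ S.filter (fun κ => g κ = (K, p)),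
        ⋃ Q ∈ D.filter (fun Q => k Q = κ), Q.set) ⊆ {x | A ^ K ≤ H x} := by
      intro x hx
      obtain ⟨κ, hκ, hx⟩ := Set.mem_iUnion₂.1 hx
      obtain ⟨Q, hQ, hx⟩ := Set.mem_iUnion₂.1 hx
      obtain ⟨hQD, hQκ⟩ := Finset.mem_filter.1 hQ
      have e : ∑ j, κ j = K := congrArg Prod.fst (Finset.mem_filter.1 hκ).2
      show A ^ K ≤ H x
      refine le_trans ?_ (le_fmax D (fun Q => ∏ j, avg (r j) (F j) Q) x Q hQD hx)
      rw [← e, ← prod_zpow_sum _ _ hA0 hAt, ← hQκ]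
      exact Finset.prod_le_prod' fun j _ => (hk Q hQD j).1.le
    calc _ ≤ (A ^ K) ^ q * (2 * volume {x | A ^ K ≤ H x}) := by
          apply mul_le_mul_right
          exact h2.trans (mul_le_mul_right (measure_mono h3) _)
      _ = _ := by ring
  refine (Finset.sum_le_sum hin).trans ?_
  rw [Finset.sum_product]
  simp only [Finset.sum_const, Finset.card_univ, nsmul_eq_mul]
  rw [← Finset.mul_sum, ← Finset.mul_sum]
  have h5 : ∑ K ∈ Z, (A ^ K) ^ q * volume {x | A ^ K ≤ H x} ≤ 2 * ∫⁻ x, H x ^ q := by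
    have : ∀ K : ℤ, (A ^ K) ^ q * volume {x | A ^ K ≤ H x} =
        ∫⁻ x, (if A ^ K ≤ H x then (A ^ K) ^ q else 0) := by
      intro K
      rw [← lintegral_indicator_const (measurableSet_le measurable_const hH)]
      apply lintegral_congr
      intro x
      by_cases hx : A ^ K ≤ H x <;> simp [Set.indicator_apply, hx]
    simp only [this]
    rw [← lintegral_finsetSum]
    · rw [← lintegral_const_mul _ (hH.pow_const q)]
      exact lintegral_mono fun x => geom_level A hAt q hq hAq Z (H x)
    · intro K _
      exact Measurable.ite (measurableSet_le measurable_const hH) measurable_const measurable_const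
  calc _ ≤ (Fintype.card (ι → Bool) : ℝ≥0∞) * (2 * (2 * ∫⁻ x, H x ^ q)) := by gcongr
    _ = _ := by ring

lemma avg_zero {d : ℕ} {Ω : Type*} [MeasurableSpace Ω] (μ : Measure Ω) [SigmaFinite μ]
    (r : ℝ≥0∞) (hr0 : r ≠ 0) (hr : r ≠ ∞) (t : ℝ≥0∞) (ht : t ≠ 0)
    (f : (Fin d → ℝ) → Ω → ℝ≥0∞) (hf : Measurable (Function.uncurry f)) (Q : Cube d)
    (h : avg r (fun x => eNorm t μ (f x)) Q = 0) :
    ∀ᵐ ω ∂μ, avg r (fun x => f x ω) Q = 0 := by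
  have hrp : 0 < r.toReal := ENNReal.toReal_pos hr0 hr
  have h1 := (lintegral_le_of_avg_le r hr0 hr _ Q 0).1 h.le
  rw [ENNReal.zero_rpow_of_pos hrp, zero_mul, nonpos_iff_eq_zero,
    lintegral_eq_zero_iff ((measurable_eNorm t μ f hf).pow_const _)] at h1
  have h2 : ∀ᵐ x ∂(volume.restrict Q.set), ∀ᵐ ω ∂μ, f x ω = 0 := by
    filter_upwards [h1] with x hx
    apply ae_zero_of_eNorm t ht μ (f x) (hf.comp measurable_prodMk_left)
    simpa [ENNReal.rpow_eq_zero_iff_of_pos hrp] using hx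
  rw [Measure.ae_ae_comm (p := fun x ω => f x ω = 0) (hf (measurableSet_singleton 0))] at h2
  filter_upwards [h2] with ω hω
  rw [← nonpos_iff_eq_zero, lintegral_le_of_avg_le r hr0 hr]
  rw [ENNReal.zero_rpow_of_pos hrp, zero_mul, nonpos_iff_eq_zero]
  refine (lintegral_congr_ae (g := fun _ => 0) ?_).trans (by simp)
  filter_upwards [hω] with x hx
  simp [hx, hrp]

open Classical in
lemma core_finite {ι : Type*} [Fintype ι] [Nonempty ι] (r t : ι → ℝ≥0∞) (hr0 : ∀ j, r j ≠ 0)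
    (hr : ∀ j, r j ≠ ∞) (hrt : ∀ j, r j < t j) (q : ℝ) (hq : 0 < q)
    (hsum : ∑ j, q * (t j)⁻¹.toReal = 1) :
    ∃ C : ℝ≥0∞, C ≠ ∞ ∧ ∀ (d : ℕ) (Ω : Type) [MeasurableSpace Ω] (μ : Measure Ω) [SigmaFinite μ]
      (D : Finset (Cube d)) (_ : Laminar (D : Set (Cube d)))
      (f : ι → (Fin d → ℝ) → Ω → ℝ≥0∞) (_ : ∀ j, Measurable (Function.uncurry (f j))),
      ∫⁻ z, (fmax D (fun Q => ∏ j, avg (r j) (fun x => f j x z.2) Q) z.1) ^ q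
          ∂((volume : Measure (Fin d → ℝ)).prod μ) ≤
        C * ∫⁻ x, (fmax D (fun Q => ∏ j, avg (r j) (fun x => eNorm (t j) μ (f j x)) Q) x) ^ q := by
  obtain ⟨C, hC, hH⟩ := holder_class r t hr0 hr hrt q hq hsum
  obtain ⟨A, hA1, hAt, hAq, hA⟩ := exists_A r hr0 hr q hq
  have hA0 : A ≠ 0 := (lt_trans (by simp) hA1).ne'
  let C₂ : ℝ≥0∞ := C * (A ^ (∑ _j : ι, (1:ℤ))) ^ q * (4 * (Fintype.card (ι → Bool) : ℝ≥0∞))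
  refine ⟨C₂ + 1, ?_, ?_⟩
  · refine ENNReal.add_ne_top.2 ⟨?_, by simp⟩
    refine ENNReal.mul_ne_top (ENNReal.mul_ne_top hC ?_) ?_
    · exact ENNReal.rpow_ne_top_of_nonneg hq.le (ENNReal.zpow_lt_top hA0 hAt _).ne
    · exact ENNReal.mul_ne_top (by norm_num) (by simp)
  intro d Ω _ μ _ D lam f hf
  let F : ι → (Fin d → ℝ) → ℝ≥0∞ := fun j x => eNorm (t j) μ (f j x)
  change _ ≤ (C₂ + 1) * ∫⁻ x, (fmax D (fun Q => ∏ j, avg (r j) (F j) Q) x) ^ q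
  by_cases hinf : ∃ Q ∈ D, ∏ j, avg (r j) (F j) Q = ∞
  · obtain ⟨Q, hQ, htop⟩ := hinf
    have : ∫⁻ x, (fmax D (fun Q => ∏ j, avg (r j) (F j) Q) x) ^ q = ∞ := by
      rw [eq_top_iff]
      calc ∞ = ∞ * volume Q.set := by rw [ENNReal.top_mul Q.vol_ne_zero]
        _ = ∫⁻ x, Q.set.indicator (fun _ => ∞) x := by rw [lintegral_indicator_const Q.meas]
        _ ≤ _ := by
          apply lintegral_mono
          intro x
          by_cases hx : x ∈ Q.set
          · have h1 := le_fmax D (fun Q => ∏ j, avg (r j) (F j) Q) x Q hQ hx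
            simp only [htop, top_le_iff] at h1
            simp only [h1, ENNReal.top_rpow_of_pos hq, le_top]
          · simp [hx]
    rw [this, ENNReal.mul_top (by simp)]
    exact le_top
  push Not at hinf
  let D' := D.filter (fun Q => ∀ j, avg (r j) (F j) Q ≠ 0 ∧ avg (r j) (F j) Q ≠ ∞)
  have hD' : D' ⊆ D := Finset.filter_subset _ _
  have lam' : ∀ 𝓖 : Finset (Cube d), 𝓖 ⊆ D → Laminar (𝓖 : Set (Cube d)) :=
    fun 𝓖 h a ha b hb => lam a (h ha) b (h hb)
  have hbad : ∀ Q ∈ D, Q ∉ D' → ∃ j, avg (r j) (F j) Q = 0 := by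
    intro Q hQ hQ'
    by_contra! hne
    apply hQ'
    refine Finset.mem_filter.2 ⟨hQ, fun j => ⟨hne j, fun hj => ?_⟩⟩
    exact hinf Q hQ (WithTop.prod_eq_top_iff.2 ⟨⟨j, Finset.mem_univ j, hj⟩, fun i _ => hne i⟩)
  let c : Ω → Cube d → ℝ≥0∞ := fun ω Q => ∏ j, avg (r j) (fun x => f j x ω) Q
  have hcm : ∀ Q, Measurable (fun ω => c ω Q) := fun Q =>
    Finset.measurable_fun_prod _ fun j _ => measurable_avg (r j) (hr j) (f j) (hf j) Q
  have hzero : ∀ᵐ ω ∂μ, ∀ Q ∈ D, Q ∉ D' → c ω Q = 0 := by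
    have : ∀ Q ∈ D, ∀ᵐ ω ∂μ, Q ∉ D' → c ω Q = 0 := by
      intro Q hQ
      by_cases hQ' : Q ∈ D'
      · exact Filter.Eventually.of_forall fun ω h => absurd hQ' h
      · obtain ⟨j, hj⟩ := hbad Q hQ hQ'
        filter_upwards [avg_zero μ (r j) (hr0 j) (hr j) (t j)
          (lt_of_le_of_lt (by simp) (hrt j)).ne' (f j) (hf j) Q hj] with ω hω _
        exact Finset.prod_eq_zero (Finset.mem_univ j) hω
    exact (Finset.eventually_all D).2 this
  have hzero2 := Measure.quasiMeasurePreserving_snd (μ := (volume : Measure (Fin d → ℝ))) (ν := μ)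
      |>.ae hzero
  have hex : ∀ Q : Cube d, ∃ κ : ι → ℤ, Q ∈ D' → ∀ j,
      A ^ (κ j) < avg (r j) (F j) Q ∧ avg (r j) (F j) Q ≤ A ^ (κ j + 1) := by
    intro Q
    by_cases hQ : Q ∈ D'
    · have := (Finset.mem_filter.1 hQ).2
      choose κ hκ using fun j => ENNReal.exists_mem_Ioc_zpow (this j).1 (this j).2 hA1 hAt
      exact ⟨κ, fun _ j => hκ j⟩
    · exact ⟨0, fun h => absurd h hQ⟩
  choose k hk using hex
  let S := D'.image k
  let E : (ι → ℤ) → Finset (Cube d) := fun κ => D'.filter (fun Q => k Q = κ)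
  have hES : ∀ κ, E κ ⊆ D := fun κ => (Finset.filter_subset _ _).trans hD'
  calc ∫⁻ z, (fmax D (c z.2) z.1) ^ q ∂((volume : Measure (Fin d → ℝ)).prod μ)
      ≤ ∫⁻ z, ∑ κ ∈ S, (fmax (E κ) (c z.2) z.1) ^ q
          ∂((volume : Measure (Fin d → ℝ)).prod μ) := by
        apply lintegral_mono_ae
        filter_upwards [hzero2] with z hz
        rw [fmax_rpow _ _ _ _ hq]
        apply fmax_le
        intro Q hQ hx
        by_cases hQ' : Q ∈ D'
        · refine le_trans ?_ (Finset.single_le_sum (f := fun κ => (fmax (E κ) (c z.2) z.1) ^ q)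
            (fun _ _ => zero_le) (Finset.mem_image_of_mem k hQ'))
          apply ENNReal.rpow_le_rpow _ hq.le
          exact le_fmax _ _ _ Q (Finset.mem_filter.2 ⟨hQ', rfl⟩) hx
        · rw [hz Q hQ hQ', ENNReal.zero_rpow_of_pos hq]
          exact zero_le
    _ = ∑ κ ∈ S, ∫⁻ z, (fmax (E κ) (c z.2) z.1) ^ q
          ∂((volume : Measure (Fin d → ℝ)).prod μ) := by
        rw [lintegral_finsetSum]
        intro κ _
        exact (measurable_fmax2 (E κ) (fun Q ω => c ω Q) hcm).pow_const q
    _ ≤ ∑ κ ∈ S, C * (A ^ (∑ _j : ι, (1:ℤ))) ^ q *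
          ((A ^ (∑ j, κ j)) ^ q * volume (⋃ Q ∈ E κ, Q.set)) := by
        apply Finset.sum_le_sum
        intro κ _
        have := hH d Ω μ (E κ) (lam' _ (hES κ)) f hf (fun j => A ^ (κ j + 1))
          (fun j => (ENNReal.zpow_pos hA0 hAt _).ne') (fun j => (ENNReal.zpow_lt_top hA0 hAt _).ne)
          (by
            intro Q hQ j
            obtain ⟨h1, h2⟩ := Finset.mem_filter.1 hQ
            have := (hk Q h1 j).2
            rwa [h2] at this)
        refine this.trans (le_of_eq ?_)
        rw [prod_zpow_sum _ _ hA0 hAt, Finset.sum_add_distrib, ENNReal.zpow_add hA0 hAt,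
          ENNReal.mul_rpow_of_nonneg _ _ hq.le]
        ring
    _ = C * (A ^ (∑ _j : ι, (1:ℤ))) ^ q * ∑ κ ∈ S,
          (A ^ (∑ j, κ j)) ^ q * volume (⋃ Q ∈ E κ, Q.set) := by rw [Finset.mul_sum]
    _ ≤ C * (A ^ (∑ _j : ι, (1:ℤ))) ^ q * (4 * (Fintype.card (ι → Bool) : ℝ≥0∞) *
        ∫⁻ x, (fmax D' (fun Q => ∏ j, avg (r j) (F j) Q) x) ^ q) := by
        apply mul_le_mul_right
        exact level_sum r hr0 hr A hA1 hAt hA q hq hAq F D' (lam' _ hD') k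
          (fun Q hQ j => hk Q hQ j) S
    _ ≤ C₂ * ∫⁻ x, (fmax D (fun Q => ∏ j, avg (r j) (F j) Q) x) ^ q := by
        rw [← mul_assoc]
        apply mul_le_mul_right
        apply lintegral_mono
        intro x
        apply ENNReal.rpow_le_rpow _ hq.le
        exact fmax_le _ _ _ _ fun Q hQ hx => le_fmax _ _ _ Q (hD' hQ) hx
    _ ≤ _ := by
        gcongr
        exact le_self_add

def gridCube {d : ℕ} (α : Fin d → Bool) (p : ℤ × (Fin d → ℤ)) : Cube d where
  corner := fun i => (2:ℝ) ^ p.1 * ((p.2 i : ℝ) + (-1) ^ p.1 * (if α i then 1 else 0) / 3)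
  side := (2:ℝ) ^ p.1
  side_pos := by positivity

lemma lattice_step (a : Bool) (k : ℤ) (j : ℕ) : ∀ m : ℤ, ∃ n : ℤ,
    (2:ℝ) ^ (k + j) * ((m : ℝ) + (-1) ^ (k + j) * (if a then 1 else 0) / 3) =
    (2:ℝ) ^ k * ((n : ℝ) + (-1) ^ k * (if a then 1 else 0) / 3) := by
  induction j with
  | zero => intro m; exact ⟨m, by simp⟩
  | succ j ih =>
    intro m
    have h_int : ∃ ε : ℤ, ((-1:ℝ)) ^ (k + j) = ε := by
      rcases Int.even_or_odd (k + j) with h | h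
      · exact ⟨1, by rw [h.neg_one_zpow]; simp⟩
      · exact ⟨-1, by rw [h.neg_one_zpow]; simp⟩
    obtain ⟨ε, hε⟩ := h_int
    obtain ⟨n, hn⟩ := ih (2 * m - ε * (if a then 1 else 0))
    refine ⟨n, ?_⟩
    rw [← hn]
    push_cast
    rw [← add_assoc, zpow_add₀ (by norm_num : (2:ℝ) ≠ 0) (k + j), zpow_add₀ (by norm_num : (-1:ℝ) ≠ 0) (k + j), hε]
    simp only [zpow_one]
    ring

lemma grid_nested {d : ℕ} (α : Fin d → Bool) (k : ℤ) (n : Fin d → ℤ) (j : ℕ) (m : Fin d → ℤ) :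
    (gridCube α (k, n)).set ⊆ (gridCube α (k + j, m)).set ∨
      Disjoint (gridCube α (k, n)).set (gridCube α (k + j, m)).set := by
  choose A hA using fun i => lattice_step (α i) k j (m i)
  choose B hB using fun i => lattice_step (α i) k j (m i + 1)
  have h2 : (0:ℝ) < 2 ^ k := by positivity
  have hcS : ∀ i, (gridCube α (k, n)).corner i =
    (2:ℝ) ^ k * ((n i : ℝ) + (-1) ^ k * (if α i then 1 else 0) / 3) := fun i => rfl
  have hcB : ∀ i, (gridCube α (k + j, m)).corner i =
    (2:ℝ) ^ k * ((A i : ℝ) + (-1) ^ k * (if α i then 1 else 0) / 3) := fun i => hA i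
  have hcT : ∀ i, (gridCube α (k + j, m)).corner i + (gridCube α (k + j, m)).side =
    (2:ℝ) ^ k * ((B i : ℝ) + (-1) ^ k * (if α i then 1 else 0) / 3) := fun i => by
    rw [← hB i]
    simp only [gridCube]
    push_cast
    ring
  have hcU : ∀ i, (gridCube α (k, n)).corner i + (gridCube α (k, n)).side =
    (2:ℝ) ^ k * ((n i : ℝ) + 1 + (-1) ^ k * (if α i then 1 else 0) / 3) := fun i => by
    simp only [gridCube]
    ring
  by_cases h : ∀ i, A i ≤ n i ∧ n i + 1 ≤ B i
  · left
    intro x hx i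
    obtain ⟨h3, h4⟩ := hx i
    rw [hcT, hcB]
    rw [hcU] at h4
    rw [hcS] at h3
    have e1 : (A i : ℝ) ≤ n i := by exact_mod_cast (h i).1
    have e2 : (n i : ℝ) + 1 ≤ B i := by exact_mod_cast (h i).2
    constructor
    · refine le_trans ?_ h3
      gcongr
    · refine lt_of_lt_of_le h4 ?_
      gcongr
  · right
    push Not at h
    obtain ⟨i, hi⟩ := h
    rw [Set.disjoint_left]
    intro x hx hx'
    obtain ⟨h3, h4⟩ := hx i
    obtain ⟨h5, h6⟩ := hx' i
    rw [hcT] at h6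
    rw [hcB] at h5
    rw [hcU] at h4
    rw [hcS] at h3
    have h7 := lt_of_le_of_lt h5 h4
    have h8 := lt_of_le_of_lt h3 h6
    rw [mul_lt_mul_iff_right₀ h2] at h7 h8
    have h9 : A i < n i + 1 := by
      have : (A i : ℝ) < n i + 1 := by linarith
      exact_mod_cast this
    have h10 : n i < B i := by
      have : (n i : ℝ) < B i := by linarith
      exact_mod_cast this
    have := hi (by omega)
    omega

lemma grid_laminar {d : ℕ} (α : Fin d → Bool) : Laminar (Set.range (gridCube α)) := by
  rintro _ ⟨⟨k, n⟩, rfl⟩ _ ⟨⟨l, m⟩, rfl⟩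
  rcases le_total k l with h | h
  · obtain ⟨j, rfl⟩ := Int.le.dest h
    rcases grid_nested α k n j m with h | h
    · exact Or.inl h
    · exact Or.inr (Or.inr h)
  · obtain ⟨j, rfl⟩ := Int.le.dest h
    rcases grid_nested α l m j n with h | h
    · exact Or.inr (Or.inl h)
    · exact Or.inr (Or.inr h.symm)

lemma third_one (k : ℤ) (c ℓ : ℝ) (h : 3 * ℓ ≤ 2 ^ k) : ∃ (a : Bool) (n : ℤ),
    (2:ℝ) ^ k * ((n : ℝ) + (-1) ^ k * (if a then 1 else 0) / 3) ≤ c ∧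
    c + ℓ ≤ (2:ℝ) ^ k * ((n : ℝ) + (-1) ^ k * (if a then 1 else 0) / 3) + (2:ℝ) ^ k := by
  have h2 : (0:ℝ) < 2 ^ k := by positivity
  set b : ℝ := 2 ^ k with hb
  have hu : c = b * (c / b) := by field_simp
  have hf1 := Int.floor_le (c / b)
  have hf2 := Int.lt_floor_add_one (c / b)
  set u := c / b with hu'
  set n : ℤ := ⌊u⌋ with hn
  by_cases hc : c + ℓ ≤ b * (n + 1)
  · refine ⟨false, n, ?_, ?_⟩
    · rw [hu]
      simp only [Bool.false_eq_true, if_false, mul_zero, zero_div, add_zero]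
      gcongr
    · simp only [Bool.false_eq_true, if_false, mul_zero, zero_div, add_zero]
      linarith
  · push Not at hc
    have h3 : (n : ℝ) + 2 / 3 < u := by
      have : b * (n + 2 / 3) < b * u := by rw [← hu]; linarith
      exact (mul_lt_mul_iff_right₀ h2).1 this
    have h4 : b * u < b * (n + 1) := by gcongr
    have h5 : b * (n + 2 / 3) < b * u := by gcongr
    rcases Int.even_or_odd k with he | he
    · refine ⟨true, n, ?_, ?_⟩
      · rw [he.neg_one_zpow]; simp only [if_true]; linarith
      · rw [he.neg_one_zpow]; simp only [if_true]; linarith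
    · refine ⟨true, n + 1, ?_, ?_⟩
      · rw [he.neg_one_zpow]; push_cast; simp only [if_true]; linarith
      · rw [he.neg_one_zpow]; push_cast; simp only [if_true]; linarith

lemma third_trick {d : ℕ} (Q : Cube d) : ∃ (α : Fin d → Bool) (p : ℤ × (Fin d → ℤ)),
    Q.set ⊆ (gridCube α p).set ∧ (gridCube α p).side ≤ 6 * Q.side := by
  have hp : 0 < 3 * Q.side := by have := Q.side_pos; positivity
  obtain ⟨k, hk1, hk2⟩ := exists_mem_Ioc_zpow hp (by norm_num : (1:ℝ) < 2)
  choose a n h using fun i => third_one (k + 1) (Q.corner i) Q.side hk2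
  refine ⟨a, (k + 1, n), ?_, ?_⟩
  · intro x hx i
    exact ⟨(h i).1.trans (hx i).1, (hx i).2.trans_le (h i).2⟩
  · show (2:ℝ) ^ (k + 1) ≤ _
    rw [zpow_add₀ (by norm_num), zpow_one]
    linarith

lemma avg_le_avg {d : ℕ} (r : ℝ≥0∞) (hr0 : r ≠ 0) (hr : r ≠ ∞) (F : (Fin d → ℝ) → ℝ≥0∞)
    (Q Q' : Cube d) (hsub : Q.set ⊆ Q'.set) (hs : Q'.side ≤ 6 * Q.side) :
    avg r F Q ≤ ((6:ℝ≥0∞) ^ d) ^ (1 / r.toReal) * avg r F Q' := by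
  have hrp : 0 < r.toReal := ENNReal.toReal_pos hr0 hr
  rw [lintegral_le_of_avg_le r hr0 hr, ENNReal.mul_rpow_of_nonneg _ _ hrp.le,
    ← ENNReal.rpow_mul, one_div, inv_mul_cancel₀ hrp.ne', ENNReal.rpow_one]
  have h1 := (lintegral_le_of_avg_le r hr0 hr F Q' (avg r F Q')).1 le_rfl
  have h2 : volume Q'.set ≤ 6 ^ d * volume Q.set := by
    rw [Q.vol_eq, Q'.vol_eq]
    have : (6:ℝ≥0∞) ^ d = ENNReal.ofReal (6 ^ d) := by
      rw [ENNReal.ofReal_pow (by norm_num)]; simp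
    rw [this, ← ENNReal.ofReal_mul (by positivity), ← mul_pow]
    apply ENNReal.ofReal_le_ofReal
    have := Q'.side_pos
    gcongr
  calc _ ≤ ∫⁻ x in Q'.set, F x ^ r.toReal := lintegral_mono_set hsub
    _ ≤ _ := h1
    _ ≤ avg r F Q' ^ r.toReal * (6 ^ d * volume Q.set) := by gcongr
    _ = _ := by ring

def gmax {d : ℕ} (c : Cube d → ℝ≥0∞) (x : Fin d → ℝ) : ℝ≥0∞ :=
  ⨆ (Q : Cube d) (_ : x ∈ Q.set), c Q

lemma le_gmax {d : ℕ} (c : Cube d → ℝ≥0∞) (x : Fin d → ℝ) (Q : Cube d) (hx : x ∈ Q.set) :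
    c Q ≤ gmax c x := le_iSup₂ (f := fun (Q : Cube d) (_ : x ∈ Q.set) => c Q) Q hx

open Classical in
lemma core_full {ι : Type*} [Fintype ι] [Nonempty ι] (r t : ι → ℝ≥0∞) (hr0 : ∀ j, r j ≠ 0)
    (hr : ∀ j, r j ≠ ∞) (hrt : ∀ j, r j < t j) (q : ℝ) (hq : 0 < q)
    (hsum : ∑ j, q * (t j)⁻¹.toReal = 1) (d : ℕ) :
    ∃ C : ℝ≥0∞, C ≠ ∞ ∧ ∀ (Ω : Type) [MeasurableSpace Ω] (μ : Measure Ω) [SigmaFinite μ]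
      (f : ι → (Fin d → ℝ) → Ω → ℝ≥0∞) (_ : ∀ j, Measurable (Function.uncurry (f j))),
      ∃ H : (Fin d → ℝ) × Ω → ℝ≥0∞, Measurable H ∧
        (∀ x ω, (gmax (fun Q => ∏ j, avg (r j) (fun x => f j x ω) Q) x) ^ q ≤ H (x, ω)) ∧
        ∫⁻ z, H z ∂((volume : Measure (Fin d → ℝ)).prod μ) ≤
        C * ∫⁻ x, (gmax (fun Q => ∏ j, avg (r j) (fun x => eNorm (t j) μ (f j x)) Q) x) ^ q := by
  obtain ⟨C, hC, hmain⟩ := core_finite r t hr0 hr hrt q hq hsum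
  let K : ℝ≥0∞ := ∏ j, ((6:ℝ≥0∞) ^ d) ^ (1 / (r j).toReal)
  have hK : K ≠ ∞ := ENNReal.prod_ne_top fun j _ =>
    ENNReal.rpow_ne_top_of_nonneg (by positivity) (ENNReal.pow_ne_top (by norm_num))
  refine ⟨∑ _α : Fin d → Bool, K ^ q * C, ?_, ?_⟩
  · exact ENNReal.sum_ne_top.2 fun _ _ =>
      ENNReal.mul_ne_top (ENNReal.rpow_ne_top_of_nonneg hq.le hK) hC
  intro Ω _ μ _ f hf
  obtain ⟨e, he⟩ := exists_surjective_nat (ℤ × (Fin d → ℤ))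
  let D : (Fin d → Bool) → ℕ → Finset (Cube d) := fun α N =>
    (Finset.range N).image (fun n => gridCube α (e n))
  have hDm : ∀ α, Monotone (D α) := fun α N N' h =>
    Finset.image_subset_image (Finset.range_subset_range.2 h)
  have hlam : ∀ α N, Laminar (D α N : Set (Cube d)) := by
    intro α N a ha b hb
    obtain ⟨n, _, rfl⟩ := Finset.mem_image.1 ha
    obtain ⟨n', _, rfl⟩ := Finset.mem_image.1 hb
    exact grid_laminar α _ ⟨_, rfl⟩ _ ⟨_, rfl⟩
  let c : Ω → Cube d → ℝ≥0∞ := fun ω Q => ∏ j, avg (r j) (fun x => f j x ω) Q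
  have hcm : ∀ Q, Measurable (fun ω => c ω Q) := fun Q =>
    Finset.measurable_fun_prod _ fun j _ => measurable_avg (r j) (hr j) (f j) (hf j) Q
  have hm : ∀ α N, Measurable (fun z : (Fin d → ℝ) × Ω => (fmax (D α N) (c z.2) z.1) ^ q) :=
    fun α N => (measurable_fmax2 (D α N) (fun Q ω => c ω Q) hcm).pow_const q
  have hm2 : ∀ α, Measurable
      (fun z : (Fin d → ℝ) × Ω => ⨆ N, (fmax (D α N) (c z.2) z.1) ^ q) :=
    fun α => Measurable.iSup (hm α)
  refine ⟨fun z => ∑ α, K ^ q * ⨆ N, (fmax (D α N) (c z.2) z.1) ^ q, ?_, ?_, ?_⟩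
  · exact Finset.measurable_fun_sum _ fun α _ => (hm2 α).const_mul _
  · intro x ω
    rw [← ENNReal.le_rpow_inv_iff hq]
    apply iSup₂_le
    intro Q hx
    rw [ENNReal.le_rpow_inv_iff hq]
    obtain ⟨α, p, hsub, hs⟩ := third_trick Q
    obtain ⟨n, rfl⟩ := he p
    have hQ' : gridCube α (e n) ∈ D α (n + 1) :=
      Finset.mem_image.2 ⟨n, by simp, rfl⟩
    calc (∏ j, avg (r j) (fun x => f j x ω) Q) ^ q
        ≤ (K * c ω (gridCube α (e n))) ^ q := by
          apply ENNReal.rpow_le_rpow _ hq.le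
          simp only [K, c]
          rw [← Finset.prod_mul_distrib]
          exact Finset.prod_le_prod' fun j _ => avg_le_avg (r j) (hr0 j) (hr j) _ _ _ hsub hs
      _ = K ^ q * c ω (gridCube α (e n)) ^ q := ENNReal.mul_rpow_of_nonneg _ _ hq.le
      _ ≤ K ^ q * (fmax (D α (n + 1)) (c ω) x) ^ q := by
          apply mul_le_mul_right
          apply ENNReal.rpow_le_rpow _ hq.le
          exact le_fmax _ _ _ _ hQ' (hsub hx)
      _ ≤ K ^ q * ⨆ N, (fmax (D α N) (c ω) x) ^ q := by
          apply mul_le_mul_right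
          exact le_iSup (fun N => (fmax (D α N) (c ω) x) ^ q) (n + 1)
      _ ≤ _ := Finset.single_le_sum
          (f := fun α => K ^ q * ⨆ N, (fmax (D α N) (c ω) x) ^ q)
          (fun _ _ => zero_le) (Finset.mem_univ α)
  · rw [lintegral_finsetSum _ fun α _ => (hm2 α).const_mul _, Finset.sum_mul]
    apply Finset.sum_le_sum
    intro α _
    rw [lintegral_const_mul _ (hm2 α), mul_assoc]
    apply mul_le_mul_right
    rw [lintegral_iSup (hm α)]
    · apply iSup_le
      intro N
      refine (hmain d Ω μ (D α N) (hlam α N) f hf).trans ?_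
      apply mul_le_mul_right
      apply lintegral_mono
      intro x
      apply ENNReal.rpow_le_rpow _ hq.le
      exact fmax_le _ _ _ _ fun Q _ hx => le_gmax _ x Q hx
    · intro N N' h z
      apply ENNReal.rpow_le_rpow _ hq.le
      exact fmax_le _ _ _ _ fun Q hQ hx => le_fmax _ _ _ Q (hDm α h hQ) hx

lemma eNorm_const_mul_le {Ω : Type*} [MeasurableSpace Ω] (u : ℝ≥0∞) (hu : u ≠ 0) (μ : Measure Ω)
    (c : ℝ≥0∞) (hc : c ≠ ∞) (h : Ω → ℝ≥0∞) (hh : eNorm u μ h ≤ 1) :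
    eNorm u μ (fun ω => c * h ω) ≤ c := by
  by_cases hut : u = ∞
  · subst hut
    rw [eNorm_top] at hh ⊢
    refine essSup_le_of_ae_le _ ?_
    filter_upwards [ENNReal.ae_le_essSup h] with ω hω
    calc c * h ω ≤ c * 1 := mul_le_mul_right (hω.trans hh) _
      _ = c := mul_one _
  · have hup : 0 < u.toReal := ENNReal.toReal_pos hu hut
    rw [eNorm_ne_top _ hut] at hh ⊢
    simp only [ENNReal.mul_rpow_of_nonneg _ _ hup.le]
    rw [lintegral_const_mul' _ _ (ENNReal.rpow_ne_top_of_nonneg hup.le hc),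
      ENNReal.mul_rpow_of_nonneg _ _ (by positivity), ← ENNReal.rpow_mul,
      mul_one_div_cancel hup.ne', ENNReal.rpow_one]
    calc _ ≤ c * 1 := mul_le_mul_right hh _
      _ = c := mul_one _

lemma nn_toReal (a : ℝ≥0∞) (ha : a ≠ ∞) : (‖((a.toReal : ℝ) : ℂ)‖₊ : ℝ≥0∞) = a := by
  have : ‖((a.toReal : ℝ) : ℂ)‖₊ = a.toNNReal := by
    ext
    simp [ENNReal.coe_toNNReal_eq_toReal]
  rw [this, ENNReal.coe_toNNReal ha]

lemma duality_trunc {X Ω : Type*} [MeasurableSpace X] [MeasurableSpace Ω] (μ : Measure Ω)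
    [SigmaFinite μ] (q τ : ℝ≥0∞) (hq0 : q ≠ 0) (hqτ : q ≤ τ) (hτ : τ ≠ ∞)
    (w : X → Ω → ℝ≥0∞) (hw : Measurable (Function.uncurry w)) (n : ℕ) (hwn : ∀ x ω, w x ω ≤ n)
    (S : Set Ω) (hS : MeasurableSet S) (hμS : μ S ≠ ∞) (hwS : ∀ x, ∀ ω ∉ S, w x ω = 0)
    (ε : ℝ≥0∞) (hε : ε ≠ 0) :
    ∃ k : X → Ω → ℂ, Measurable (Function.uncurry k) ∧ (∃ M : ℝ, ∀ x ω, ‖k x ω‖ ≤ M) ∧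
      (∀ x, eNorm (q⁻¹ - τ⁻¹)⁻¹ μ (nn (k x)) ≤ 1) ∧
      ∀ x, (if ε < eNorm τ μ (w x) then eNorm τ μ (w x) ^ q.toReal else 0) ≤
        ∫⁻ ω, w x ω ^ q.toReal * nn (k x) ω ^ q.toReal ∂μ := by
  classical
  have hq : q ≠ ∞ := ne_top_of_le_ne_top hτ hqτ
  have hτ0 : τ ≠ 0 := fun h => hq0 (by rw [h] at hqτ; exact nonpos_iff_eq_zero.1 hqτ)
  have hqp : 0 < q.toReal := ENNReal.toReal_pos hq0 hq
  have hτp : 0 < τ.toReal := ENNReal.toReal_pos hτ0 hτ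
  have hle : q.toReal ≤ τ.toReal := ENNReal.toReal_mono hτ hqτ
  set a : ℝ := q.toReal with ha
  set b : ℝ := τ.toReal with hb
  set θ : ℝ := (b - a) / a with hθ
  have hθ0 : 0 ≤ θ := div_nonneg (by linarith) hqp.le
  let N : X → ℝ≥0∞ := fun x => eNorm τ μ (w x)
  have hN : Measurable N := measurable_eNorm τ μ w hw
  have hNb : ∀ x, N x ^ b = ∫⁻ ω, w x ω ^ b ∂μ := by
    intro x
    simp only [N]
    rw [eNorm_ne_top _ hτ, ← ENNReal.rpow_mul, one_div, inv_mul_cancel₀ hτp.ne', ENNReal.rpow_one]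
  have hNt : ∀ x, N x ≠ ∞ := by
    intro x h
    have h1 := hNb x
    rw [h, ENNReal.top_rpow_of_pos hτp] at h1
    have h2 : ∫⁻ ω, w x ω ^ b ∂μ ≤ (n : ℝ≥0∞) ^ b * μ S := by
      rw [← lintegral_indicator_const hS]
      apply lintegral_mono
      intro ω
      by_cases hω : ω ∈ S
      · simp only [Set.indicator_of_mem hω]
        exact ENNReal.rpow_le_rpow (hwn x ω) hτp.le
      · simp [hwS x ω hω, hτp]
    rw [← h1] at h2
    exact ENNReal.mul_ne_top (ENNReal.rpow_ne_top_of_nonneg hτp.le (by simp)) hμS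
      (top_le_iff.1 h2)
  let M : ℝ≥0∞ := ((n : ℝ≥0∞) / ε) ^ θ
  have hM : M ≠ ∞ := ENNReal.rpow_ne_top_of_nonneg hθ0 (ENNReal.div_ne_top (by simp) hε)
  let K : X → Ω → ℝ≥0∞ := fun x ω => if ε < N x then (w x ω / N x) ^ θ else 0
  have hKM : ∀ x ω, K x ω ≤ M := by
    intro x ω
    simp only [K]
    split_ifs with h
    · exact ENNReal.rpow_le_rpow (ENNReal.div_le_div (hwn x ω) h.le) hθ0
    · exact zero_le
  have hKt : ∀ x ω, K x ω ≠ ∞ := fun x ω => ne_top_of_le_ne_top hM (hKM x ω)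
  have hKm : Measurable (Function.uncurry K) := by
    apply Measurable.ite
    · exact measurableSet_lt measurable_const (hN.comp measurable_fst)
    · exact (hw.div (hN.comp measurable_fst)).pow_const θ
    · exact measurable_const
  have hnn : ∀ x ω, nn (fun ω => (((K x ω).toReal : ℝ) : ℂ)) ω = K x ω := fun x ω =>
    nn_toReal _ (hKt x ω)
  refine ⟨fun x ω => (((K x ω).toReal : ℝ) : ℂ), ?_, ⟨M.toReal, ?_⟩, ?_, ?_⟩
  · exact Complex.measurable_ofReal.comp hKm.ennreal_toReal
  · intro x ω
    simp only [Complex.norm_real, Real.norm_eq_abs, abs_of_nonneg ENNReal.toReal_nonneg]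
    exact ENNReal.toReal_mono hM (hKM x ω)
  · intro x
    rw [funext (hnn x)]
    rcases eq_or_lt_of_le hqτ with he | hlt
    · rw [he, tsub_self, ENNReal.inv_zero, eNorm_top]
      refine essSup_le_of_ae_le _ ?_
      apply Filter.Eventually.of_forall
      intro ω
      have : θ = 0 := by rw [hθ, ha, hb, he]; simp
      simp only [K, this, ENNReal.rpow_zero]
      split_ifs <;> simp
    · have hu : q⁻¹ - τ⁻¹ ≠ 0 := (tsub_pos_of_lt (ENNReal.inv_lt_inv.2 hlt)).ne'
      have hut : (q⁻¹ - τ⁻¹)⁻¹ ≠ ∞ := ENNReal.inv_ne_top.2 hu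
      have hval : ((q⁻¹ - τ⁻¹)⁻¹).toReal = (a⁻¹ - b⁻¹)⁻¹ := by
        rw [ENNReal.toReal_inv, ENNReal.toReal_sub_of_le (ENNReal.inv_le_inv.2 hqτ)
          (ENNReal.inv_ne_top.2 hq0), ENNReal.toReal_inv, ENNReal.toReal_inv]
      have hab : a < b := (ENNReal.toReal_lt_toReal hq hτ).2 hlt
      have hprod : θ * (a⁻¹ - b⁻¹)⁻¹ = b := by
        have : b - a ≠ 0 := by linarith
        rw [hθ, inv_sub_inv hqp.ne' hτp.ne', inv_div]
        field_simp
      have hpos : 0 < (a⁻¹ - b⁻¹)⁻¹ := by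
        rw [inv_pos, sub_pos]
        exact inv_strictAnti₀ hqp hab
      rw [eNorm_ne_top _ hut, hval]
      apply ENNReal.rpow_le_one _ (by positivity)
      by_cases hx : ε < N x
      · simp only [K, hx, if_true]
        simp only [← ENNReal.rpow_mul, hprod, ENNReal.div_rpow_of_nonneg _ _ hτp.le]
        have hN0 : N x ^ b ≠ 0 := by
          rw [Ne, ENNReal.rpow_eq_zero_iff_of_pos hτp]
          exact (lt_of_le_of_lt zero_le hx).ne'
        simp only [div_eq_mul_inv]
        rw [lintegral_mul_const' _ _ (ENNReal.inv_ne_top.2 hN0), ← hNb]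
        exact ENNReal.mul_inv_le_one _
      · simp [K, hx, hpos]
  · intro x
    by_cases hx : ε < N x
    · have hx' : ε < eNorm τ μ (w x) := hx
      rw [if_pos hx']
      have hN0 : N x ≠ 0 := (lt_of_le_of_lt zero_le hx).ne'
      have hc0 : N x ^ (b - a) ≠ 0 := (ENNReal.rpow_pos (pos_iff_ne_zero.2 hN0) (hNt x)).ne'
      have hct : N x ^ (b - a) ≠ ∞ := ENNReal.rpow_ne_top_of_nonneg (by linarith) (hNt x)
      have e1 : ∀ ω, w x ω ^ a * nn (fun ω => (((K x ω).toReal : ℝ) : ℂ)) ω ^ a =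
          w x ω ^ b * (N x ^ (b - a))⁻¹ := by
        intro ω
        rw [hnn]
        simp only [K, hx, if_true]
        rw [← ENNReal.rpow_mul, hθ, div_mul_cancel₀ _ hqp.ne',
          ENNReal.div_rpow_of_nonneg _ _ (by linarith), div_eq_mul_inv, ← mul_assoc,
          ← ENNReal.rpow_add_of_nonneg _ _ hqp.le (by linarith)]
        congr 2
        ring
      rw [lintegral_congr e1, lintegral_mul_const' _ _ (ENNReal.inv_ne_top.2 hc0), ← hNb,
        ← ENNReal.rpow_neg, ← ENNReal.rpow_add _ _ hN0 (hNt x)]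
      apply le_of_eq
      show N x ^ a = _
      congr 1
      ring
    · have hx' : ¬ ε < eNorm τ μ (w x) := hx
      rw [if_neg hx']
      exact zero_le

lemma eNorm_le_of_lintegral {α : Type*} [MeasurableSpace α] (q : ℝ≥0∞) (hq0 : q ≠ 0) (hq : q ≠ ∞)
    (ν : Measure α) (F G : α → ℝ≥0∞) (c : ℝ≥0∞) :
    eNorm q ν F ≤ c * eNorm q ν G ↔
      ∫⁻ x, F x ^ q.toReal ∂ν ≤ c ^ q.toReal * ∫⁻ x, G x ^ q.toReal ∂ν := by
  have hqp : 0 < q.toReal := ENNReal.toReal_pos hq0 hq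
  rw [eNorm_ne_top _ hq, eNorm_ne_top _ hq, one_div, ENNReal.rpow_inv_le_iff hqp,
    ENNReal.mul_rpow_of_nonneg _ _ hqp.le, ← ENNReal.rpow_mul, inv_mul_cancel₀ hqp.ne',
    ENNReal.rpow_one]

lemma eNorm_mono {α : Type*} [MeasurableSpace α] (q : ℝ≥0∞) (hq : q ≠ ∞)
    (ν : Measure α) (F G : α → ℝ≥0∞) (h : ∀ x, F x ≤ G x) : eNorm q ν F ≤ eNorm q ν G := by
  rw [eNorm_ne_top _ hq, eNorm_ne_top _ hq]
  apply ENNReal.rpow_le_rpow _ (by positivity)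
  exact lintegral_mono fun x => ENNReal.rpow_le_rpow (h x) (by positivity)

lemma trunc_limit {X Ω : Type*} [MeasurableSpace X] [MeasurableSpace Ω] (ν : Measure X)
    (μ : Measure Ω) [SigmaFinite μ] (q τ : ℝ≥0∞) (hq0 : q ≠ 0) (hq : q ≠ ∞) (hτ0 : τ ≠ 0)
    (hτ : τ ≠ ∞) (w : ℕ → X → Ω → ℝ≥0∞) (hw : ∀ n, Measurable (Function.uncurry (w n)))
    (hmono : ∀ n n', n ≤ n' → ∀ x ω, w n x ω ≤ w n' x ω)
    (W : X → Ω → ℝ≥0∞) (hW : ∀ x ω, W x ω = ⨆ n, w n x ω)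
    (g : X → ℝ≥0∞) (hg : Measurable g) (B : ℝ≥0∞)
    (hB : ∀ n : ℕ, ∫⁻ x, (if ((n:ℝ≥0∞) + 1)⁻¹ < eNorm τ μ (w n x) then
      eNorm τ μ (w n x) ^ q.toReal else 0) * g x ^ q.toReal ∂ν ≤ B) :
    ∫⁻ x, (eNorm τ μ (W x) * g x) ^ q.toReal ∂ν ≤ B := by
  have hqp : 0 < q.toReal := ENNReal.toReal_pos hq0 hq
  have hτp : 0 < τ.toReal := ENNReal.toReal_pos hτ0 hτ
  let N : ℕ → X → ℝ≥0∞ := fun n x => eNorm τ μ (w n x)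
  have hNm : ∀ n, Measurable (N n) := fun n => measurable_eNorm τ μ (w n) (hw n)
  have hNmono : ∀ n n', n ≤ n' → ∀ x, N n x ≤ N n' x := fun n n' h x =>
    eNorm_mono τ hτ μ _ _ (hmono n n' h x)
  let χ : ℕ → X → ℝ≥0∞ := fun n x =>
    if ((n:ℝ≥0∞) + 1)⁻¹ < N n x then N n x ^ q.toReal else 0
  have hχm : ∀ n, Measurable (χ n) := fun n =>
    Measurable.ite (measurableSet_lt measurable_const (hNm n)) ((hNm n).pow_const _)
      measurable_const
  have hχmono : Monotone χ := by
    intro n n' h x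
    simp only [χ]
    by_cases h1 : ((n:ℝ≥0∞) + 1)⁻¹ < N n x
    · have h2 : ((n':ℝ≥0∞) + 1)⁻¹ < N n' x := by
        refine lt_of_le_of_lt ?_ (lt_of_lt_of_le h1 (hNmono n n' h x))
        apply ENNReal.inv_le_inv.2
        gcongr
      rw [if_pos h1, if_pos h2]
      exact ENNReal.rpow_le_rpow (hNmono n n' h x) hqp.le
    · rw [if_neg h1]; exact zero_le
  have hNsup : ∀ x, eNorm τ μ (W x) ^ q.toReal ≤ ⨆ n, χ n x := by
    intro x
    have h1 : ∀ n, N n x ^ q.toReal ≤ ⨆ n, χ n x := by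
      intro n
      by_cases h0 : N n x = 0
      · rw [h0, ENNReal.zero_rpow_of_pos hqp]; exact zero_le
      · obtain ⟨k, hk⟩ := ENNReal.exists_inv_nat_lt h0
        refine le_trans ?_ (le_iSup _ (max n k))
        have h2 : (((max n k : ℕ):ℝ≥0∞) + 1)⁻¹ < N (max n k) x := by
          refine lt_of_le_of_lt ?_ (lt_of_lt_of_le hk (hNmono n _ (le_max_left _ _) x))
          apply ENNReal.inv_le_inv.2
          refine le_trans ?_ le_self_add
          exact_mod_cast le_max_right n k
        simp only [χ]
        rw [if_pos h2]
        exact ENNReal.rpow_le_rpow (hNmono n _ (le_max_left _ _) x) hqp.le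
    rw [← ENNReal.le_rpow_inv_iff hqp, eNorm_ne_top _ hτ, one_div, ENNReal.rpow_inv_le_iff hτp]
    have h3 : ∀ ω, W x ω ^ τ.toReal = ⨆ n, w n x ω ^ τ.toReal := by
      intro ω
      rw [hW]
      exact (ENNReal.orderIsoRpow τ.toReal hτp).map_iSup _
    rw [lintegral_congr h3, lintegral_iSup]
    · apply iSup_le
      intro n
      rw [← ENNReal.rpow_inv_le_iff hτp, ENNReal.le_rpow_inv_iff hqp]
      have := h1 n
      simp only [N] at this
      rwa [eNorm_ne_top _ hτ, one_div] at this
    · intro n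
      exact ((hw n).comp measurable_prodMk_left).pow_const _
    · intro n n' h ω
      exact ENNReal.rpow_le_rpow (hmono n n' h x ω) hτp.le
  calc _ ≤ ∫⁻ x, ⨆ n, χ n x * g x ^ q.toReal ∂ν := by
        apply lintegral_mono
        intro x
        beta_reduce
        rw [← ENNReal.iSup_mul]
        simp only [ENNReal.mul_rpow_of_nonneg _ _ hqp.le]
        gcongr
        exact hNsup x
    _ = ⨆ n, ∫⁻ x, χ n x * g x ^ q.toReal ∂ν := by
        rw [lintegral_iSup]
        · exact fun n => (hχm n).mul (hg.pow_const _)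
        · intro n n' h x
          exact mul_le_mul_left (hχmono h x) _
    _ ≤ B := iSup_le hB

lemma memLinftyC_slice {d : ℕ} {Ω : Type*} [MeasurableSpace Ω] (f : (Fin d → ℝ) → Ω → ℂ)
    (hf : PairSimple f) (ω : Ω) : MemLinftyC (fun x => f x ω) := by
  obtain ⟨h1, h2, B, hB, h3⟩ := hf
  refine ⟨h1.comp measurable_prodMk_right, ?_, hB.subset ?_⟩
  · obtain ⟨M, hM⟩ := h2.isBounded.exists_norm_le
    exact ⟨M, fun x => hM _ ⟨(x, ω), rfl⟩⟩
  · intro x hx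
    by_contra hxB
    exact hx (h3 x hxB ω)

lemma key_step (d m : ℕ)
    (r : Fin m → ℝ≥0∞) (hr : ∀ j, 0 < r j ∧ r j ≠ ∞)
    (q s : ℝ≥0∞) (hq : 0 < q) (hq' : q ≠ ∞) (hqs : q < s)
    (t : Fin m → ℝ≥0∞) (hrt : ∀ j, r j < t j)
    (hqt : q ≤ (∑ j, (t j)⁻¹)⁻¹) (hts : (∑ j, (t j)⁻¹)⁻¹ < s)
    (htfin : (∑ j, (t j)⁻¹)⁻¹ ≠ ∞) :
    ∃ C : ℝ≥0∞, C ≠ ∞ ∧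
      ∀ (Ω : Type) [MeasurableSpace Ω] (μ : Measure Ω) [SigmaFinite μ]
        (f : Fin m → (Fin d → ℝ) → Ω → ℝ≥0∞) (_ : ∀ j, Measurable (Function.uncurry (f j)))
        (h : (Fin d → ℝ) → Ω → ℝ≥0∞) (_ : Measurable (Function.uncurry h))
        (G : (Fin d → ℝ) → ℝ≥0∞)
        (_ : ∀ x, eNorm (q⁻¹ - ((∑ j, (t j)⁻¹)⁻¹)⁻¹)⁻¹ μ (h x) ≤ G x),
      ∃ H : (Fin d → ℝ) × Ω → ℝ≥0∞, Measurable H ∧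
        (∀ x ω, (maximalX r (q⁻¹ - s⁻¹)⁻¹ (fun j x => f j x ω) (fun x => h x ω) x) ^ q.toReal
          ≤ H (x, ω)) ∧
        ∫⁻ z, H z ∂((volume : Measure (Fin d → ℝ)).prod μ) ≤
        C * ∫⁻ x, (maximalX r (q⁻¹ - s⁻¹)⁻¹ (fun j x => eNorm (t j) μ (f j x)) G x) ^ q.toReal := by
  have hqp : 0 < q.toReal := ENNReal.toReal_pos hq.ne' hq'
  set τ := (∑ j, (t j)⁻¹)⁻¹ with hτ
  set ρ := (q⁻¹ - s⁻¹)⁻¹ with hρ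
  set u := (q⁻¹ - τ⁻¹)⁻¹ with hu
  have hqi : q⁻¹ ≠ ∞ := ENNReal.inv_ne_top.2 hq.ne'
  have hρ0 : ρ ≠ 0 := ENNReal.inv_ne_zero.2 (ne_top_of_le_ne_top hqi tsub_le_self)
  have hρt : ρ ≠ ∞ := ENNReal.inv_ne_top.2 (tsub_pos_of_lt (ENNReal.inv_lt_inv.2 hqs)).ne'
  have hρu : ρ < u := by
    apply ENNReal.inv_lt_inv.2
    have h1 : s⁻¹ < τ⁻¹ := ENNReal.inv_lt_inv.2 hts
    have h2 : τ⁻¹ ≤ q⁻¹ := ENNReal.inv_le_inv.2 hqt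
    have h3 : τ⁻¹ ≠ ∞ := ne_top_of_le_ne_top hqi h2
    rw [lt_tsub_iff_right]
    calc q⁻¹ - τ⁻¹ + s⁻¹ < q⁻¹ - τ⁻¹ + τ⁻¹ :=
          ENNReal.add_lt_add_left (ne_top_of_le_ne_top hqi tsub_le_self) h1
      _ = q⁻¹ := tsub_add_cancel_of_le h2
  let r' : Option (Fin m) → ℝ≥0∞ := fun o => o.elim ρ r
  let t' : Option (Fin m) → ℝ≥0∞ := fun o => o.elim u t
  have hsum : ∑ j, q.toReal * (t' j)⁻¹.toReal = 1 := by
    rw [← Finset.mul_sum, Fintype.sum_option]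
    have h1 : ∑ j, (t' (some j))⁻¹.toReal = τ⁻¹.toReal := by
      rw [hτ, inv_inv, ENNReal.toReal_sum]
      · rfl
      · intro j _
        exact ENNReal.inv_ne_top.2 (lt_of_le_of_lt zero_le (hrt j)).ne'
    have h2 : (t' none)⁻¹.toReal = q⁻¹.toReal - τ⁻¹.toReal := by
      show u⁻¹.toReal = _
      rw [hu, inv_inv, ENNReal.toReal_sub_of_le (ENNReal.inv_le_inv.2 hqt) hqi]
    rw [h1, h2, sub_add_cancel, ENNReal.toReal_inv, mul_inv_cancel₀ hqp.ne']
  obtain ⟨C, hC, hmain⟩ := core_full r' t'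
    (by rintro (_ | j); exacts [hρ0, (hr j).1.ne'])
    (by rintro (_ | j); exacts [hρt, (hr j).2])
    (by rintro (_ | j); exacts [hρu, hrt j]) q.toReal hqp hsum d
  refine ⟨C, hC, ?_⟩
  intro Ω _ μ _ f hf h hh G hG
  obtain ⟨H, hHm, hH1, hH2⟩ := hmain Ω μ (fun o => o.elim h f)
    (by rintro (_ | j); exacts [hh, hf j])
  refine ⟨H, hHm, ?_, ?_⟩
  · intro x ω
    refine le_trans (le_of_eq ?_) (hH1 x ω)
    congr 1
    unfold maximalX gmax
    simp only [Fintype.prod_option]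
    refine iSup_congr fun Q => iSup_congr fun _ => ?_
    rw [mul_comm]
    rfl
  · refine hH2.trans (mul_le_mul_right (lintegral_mono fun x => ?_) _)
    apply ENNReal.rpow_le_rpow _ hqp.le
    unfold maximalX gmax
    simp only [Fintype.prod_option]
    refine iSup_mono fun Q => iSup_mono fun _ => ?_
    rw [mul_comm]
    apply mul_le_mul_right
    exact avg_mono_ae ρ hρt _ _ Q (Filter.Eventually.of_forall hG)

/-- scalar-valued sparse-form domination implies `L^t(Ω)`-valued
sparse-form domination (both formulated via multisublinear maximal operators). -/
theorem statement13 (d m : ℕ) (hd : 1 ≤ d) (hm : 1 ≤ m)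
    (r : Fin m → ℝ≥0∞) (hr : ∀ j, 0 < r j ∧ r j ≠ ∞)
    (q s : ℝ≥0∞) (hq : 0 < q) (hq' : q ≠ ∞) (hqs : q < s)
    (t : Fin m → ℝ≥0∞) (hrt : ∀ j, r j < t j)
    (hqt : q ≤ (∑ j, (t j)⁻¹)⁻¹) (hts : (∑ j, (t j)⁻¹)⁻¹ < s)
    (htfin : (∑ j, (t j)⁻¹)⁻¹ ≠ ∞) :
    ∃ C : ℝ≥0∞, 0 < C ∧ C ≠ ∞ ∧
      ∀ (Ω : Type) [MeasurableSpace Ω] (μ : Measure Ω) [SigmaFinite μ],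
      ∀ (T : (Fin m → ((Fin d → ℝ) → ℂ)) → ((Fin d → ℝ) → ℂ)) (C_T : ℝ≥0∞),
        -- T maps tuples of functions in L^∞_c to measurable functions
        (∀ f, (∀ j, MemLinftyC (f j)) → Measurable (T f)) →
        -- scalar-valued domination
        (∀ f g, (∀ j, MemLinftyC (f j)) → MemLinftyC g →
          eNorm q volume (fun x => nn (T f) x * nn g x) ≤
            C_T * eNorm q volume
              (maximalX r (q⁻¹ - s⁻¹)⁻¹ (fun j => nn (f j)) (nn g))) →
        -- joint measurability of the extension on simple functions
        (∀ f : Fin m → (Fin d → ℝ) → Ω → ℂ, (∀ j, PairSimple (f j)) →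
          Measurable (Function.uncurry fun x ω => T (fun j y => f j y ω) x)) →
        -- vector-valued domination
        ∀ (f : Fin m → (Fin d → ℝ) → Ω → ℂ), (∀ j, PairSimple (f j)) →
        ∀ (g : (Fin d → ℝ) → ℂ), MemLinftyC g →
          eNorm q volume (fun x =>
              eNorm (∑ j, (t j)⁻¹)⁻¹ μ
                (fun ω => (‖T (fun j y => f j y ω) x‖₊ : ℝ≥0∞)) * nn g x) ≤
            C * C_T * eNorm q volume
              (maximalX r (q⁻¹ - s⁻¹)⁻¹
                (fun j x => eNorm (t j) μ (nn (f j x))) (nn g)) := by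
  obtain ⟨C₀, hC₀, hkey⟩ := key_step d m r hr q s hq hq' hqs t hrt hqt hts htfin
  have hqp : 0 < q.toReal := ENNReal.toReal_pos hq.ne' hq'
  refine ⟨C₀ ^ (1 / q.toReal) + 1, by positivity, ENNReal.add_ne_top.2
    ⟨ENNReal.rpow_ne_top_of_nonneg (by positivity) hC₀, by simp⟩, ?_⟩
  intro Ω _ μ _ T C_T _hT hdom hjoint f hf g hg
  set τ := (∑ j, (t j)⁻¹)⁻¹ with hτ
  have hτ0 : τ ≠ 0 := fun h => hq.ne' (by rw [h] at hqt; exact nonpos_iff_eq_zero.1 hqt)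
  let W : (Fin d → ℝ) → Ω → ℝ≥0∞ := fun x ω => (‖T (fun j y => f j y ω) x‖₊ : ℝ≥0∞)
  have hWm : Measurable (Function.uncurry W) := (hjoint f hf).nnnorm.coe_nnreal_ennreal
  let w : ℕ → (Fin d → ℝ) → Ω → ℝ≥0∞ := fun n x ω =>
    (spanningSets μ n).indicator (fun ω => min (W x ω) n) ω
  have hwle : ∀ n x ω, w n x ω ≤ W x ω := by
    intro n x ω
    simp only [w]
    by_cases h : ω ∈ spanningSets μ n
    · rw [Set.indicator_of_mem h]; exact min_le_left _ _
    · rw [Set.indicator_of_notMem h]; exact zero_le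
  have hwm : ∀ n, Measurable (Function.uncurry (w n)) := by
    intro n
    have h1 : Measurable (fun z : (Fin d → ℝ) × Ω => min (W z.1 z.2) (n : ℝ≥0∞)) :=
      hWm.min measurable_const
    have h2 := h1.indicator (measurable_snd (measurableSet_spanningSets μ n))
    exact h2
  have hwmono : ∀ n n', n ≤ n' → ∀ x ω, w n x ω ≤ w n' x ω := by
    intro n n' h x ω
    simp only [w]
    by_cases h1 : ω ∈ spanningSets μ n
    · rw [Set.indicator_of_mem h1, Set.indicator_of_mem (monotone_spanningSets μ h h1)]
      apply min_le_min le_rfl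
      exact_mod_cast h
    · rw [Set.indicator_of_notMem h1]; exact zero_le
  have hWsup : ∀ x ω, W x ω = ⨆ n, w n x ω := by
    intro x ω
    apply le_antisymm _ (iSup_le fun n => hwle n x ω)
    obtain ⟨n₁, hn₁⟩ := exists_nat_ge (‖T (fun j y => f j y ω) x‖₊)
    have h2 : ω ∈ ⋃ n, spanningSets μ n := by rw [iUnion_spanningSets]; trivial
    obtain ⟨n₂, hn₂⟩ := Set.mem_iUnion.1 h2
    refine le_trans ?_ (le_iSup _ (max n₁ n₂))
    simp only [w]
    rw [Set.indicator_of_mem (monotone_spanningSets μ (le_max_right _ _) hn₂)]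
    apply le_min le_rfl
    have h3 : W x ω ≤ (n₁ : ℝ≥0∞) := by
      simp only [W]
      exact_mod_cast hn₁
    refine h3.trans ?_
    exact_mod_cast le_max_left _ _
  have hgm : Measurable (nn g) := hg.1.nnnorm.coe_nnreal_ennreal
  have hmain : ∫⁻ x, (eNorm τ μ (W x) * nn g x) ^ q.toReal ≤
      C_T ^ q.toReal * (C₀ * ∫⁻ x, (maximalX r (q⁻¹ - s⁻¹)⁻¹
        (fun j x => eNorm (t j) μ (nn (f j x))) (nn g) x) ^ q.toReal) := by
    refine trunc_limit volume μ q τ hq.ne' hq' hτ0 htfin w hwm hwmono W hWsup (nn g) hgm _ ?_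
    intro n
    obtain ⟨k, hkm, ⟨M, hkM⟩, hk1, hk2⟩ := duality_trunc μ q τ hq.ne' hqt htfin (w n) (hwm n) n
      (by
        intro x ω
        simp only [w]
        by_cases h1 : ω ∈ spanningSets μ n
        · rw [Set.indicator_of_mem h1]; exact min_le_right _ _
        · rw [Set.indicator_of_notMem h1]; exact zero_le)
      (spanningSets μ n) (measurableSet_spanningSets μ n) (measure_spanningSets_lt_top μ n).ne
      (fun x ω h => Set.indicator_of_notMem h _) ((n:ℝ≥0∞) + 1)⁻¹ (by simp)
    let h : (Fin d → ℝ) → Ω → ℂ := fun x ω => g x * k x ω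
    have hhm : Measurable (Function.uncurry h) := (hg.1.comp measurable_fst).mul hkm
    have hnnh : ∀ x, nn (h x) = fun ω => nn g x * nn (k x) ω := by
      intro x
      funext ω
      simp only [nn, h, nnnorm_mul, ENNReal.coe_mul]
    obtain ⟨H, hHm, hH1, hH2⟩ := hkey Ω μ (fun j x => nn (f j x))
      (fun j => (hf j).1.nnnorm.coe_nnreal_ennreal) (fun x => nn (h x))
      hhm.nnnorm.coe_nnreal_ennreal (nn g)
      (by
        intro x
        rw [hnnh]
        apply eNorm_const_mul_le _ _ μ (nn g x) (by simp [nn]) _ (hk1 x)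
        exact ENNReal.inv_ne_zero.2 (ne_top_of_le_ne_top (ENNReal.inv_ne_top.2 hq.ne')
          tsub_le_self))
    have hmemh : ∀ ω, MemLinftyC (fun x => h x ω) := by
      intro ω
      obtain ⟨h1, ⟨M', hM'⟩, h3⟩ := hg
      refine ⟨hhm.comp measurable_prodMk_right, ⟨M' * M, ?_⟩, h3.subset ?_⟩
      · intro x
        simp only [h, norm_mul]
        exact mul_le_mul (hM' x) (hkM x ω) (norm_nonneg _) ((norm_nonneg _).trans (hM' x))
      · intro x hx
        exact left_ne_zero_of_mul hx
    have hscal : ∀ ω, ∫⁻ x, (W x ω * nn (h x) ω) ^ q.toReal ≤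
        C_T ^ q.toReal * ∫⁻ x, H (x, ω) := by
      intro ω
      have h1 := hdom (fun j y => f j y ω) (fun x => h x ω)
        (fun j => memLinftyC_slice (f j) (hf j) ω) (hmemh ω)
      rw [eNorm_le_of_lintegral q hq.ne' hq'] at h1
      refine le_trans h1 (mul_le_mul_right (lintegral_mono fun x => ?_) _)
      exact hH1 x ω
    calc _ ≤ ∫⁻ x, ∫⁻ ω, (W x ω * nn (h x) ω) ^ q.toReal ∂μ := by
          apply lintegral_mono
          intro x
          refine le_trans (mul_le_mul_left (hk2 x) _) ?_
          rw [← lintegral_mul_const' _ _ (ENNReal.rpow_ne_top_of_nonneg hqp.le (by simp [nn]))]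
          apply lintegral_mono
          intro ω
          rw [hnnh]
          simp only [ENNReal.mul_rpow_of_nonneg _ _ hqp.le]
          calc w n x ω ^ q.toReal * nn (k x) ω ^ q.toReal * nn g x ^ q.toReal
              ≤ W x ω ^ q.toReal * nn (k x) ω ^ q.toReal * nn g x ^ q.toReal := by
                gcongr
                exact hwle n x ω
            _ = _ := by ring
      _ = ∫⁻ ω, ∫⁻ x, (W x ω * nn (h x) ω) ^ q.toReal ∂volume ∂μ := by
          apply lintegral_lintegral_swap
          exact ((hWm.mul hhm.nnnorm.coe_nnreal_ennreal).pow_const _).aemeasurable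
      _ ≤ ∫⁻ ω, C_T ^ q.toReal * (∫⁻ x, H (x, ω)) ∂μ := lintegral_mono hscal
      _ = C_T ^ q.toReal * ∫⁻ ω, (∫⁻ x, H (x, ω)) ∂μ :=
          lintegral_const_mul _ hHm.lintegral_prod_left'
      _ = C_T ^ q.toReal * ∫⁻ z, H z ∂((volume : Measure (Fin d → ℝ)).prod μ) := by
          rw [lintegral_prod_symm' _ hHm]
      _ ≤ _ := mul_le_mul_right hH2 _
  rw [eNorm_le_of_lintegral q hq.ne' hq']
  refine hmain.trans ?_
  rw [← mul_assoc]
  apply mul_le_mul_left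
  rw [ENNReal.mul_rpow_of_nonneg _ _ hqp.le, mul_comm]
  apply mul_le_mul_left
  rw [← ENNReal.rpow_inv_le_iff hqp, one_div]
  exact le_self_add

end
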